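/- arXiv:0908.4048 — 4 statements merged into one kernel-verified Lean document; each statement's English description precedes it below -/
import Mathlib

section
/- Let n, r be positive integers, let S be a symmetric (n+r)×(n+r) real matrix in block form S = [[S11, S12],[S12ᵀ, S22]] with S11 of size n×n and S22 of size r×r, let q be an invertible r×r real matrix, and set dQ := [[0,0],[0,q]]. Assume that S·dQ is symmetric, that Re(S·dQ) is negative semidefinite, and that the kernel of Re(S·dQ), as a linear map on ℝ^{n+r}, has dimension exactly n. Then S22·q is symmetric negative definite. -/
open Matrix

/-- The symmetric part `Re M = (M + Mᵀ)/2` of a square real matrix. -/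
noncomputable def reMat {ι : Type*} (M : Matrix ι ι ℝ) : Matrix ι ι ℝ :=
  ((1 : ℝ) / 2) • (M + Mᵀ)

/-- The symmetric part of a symmetric matrix is the matrix itself. -/
theorem reMat_eq_self {ι : Type*} {M : Matrix ι ι ℝ} (h : M.IsSymm) : reMat M = M := by
  rw [reMat, h.eq, ← two_smul ℝ M, smul_smul]
  norm_num

/-- If the kernel of `[[0,0],[0,A]]` is no larger than the kernel of its zero block, then `A` has
trivial kernel. -/
theorem eq_zero_of_mulVec_eq_zero_of_finrank_ker_fromBlocks {m k : Type*} [Fintype m] [Fintype k]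
    [DecidableEq m] [DecidableEq k] {A : Matrix k k ℝ}
    (hker : Module.finrank ℝ
      (LinearMap.ker (Matrix.toLin' (fromBlocks (0 : Matrix m m ℝ) 0 0 A))) = Fintype.card m)
    {x : k → ℝ} (hx : A *ᵥ x = 0) : x = 0 := by
  let e : (m → ℝ) →ₗ[ℝ] (m ⊕ k → ℝ) :=
    (LinearEquiv.sumArrowLequivProdArrow m k ℝ ℝ).symm.toLinearMap ∘ₗ LinearMap.inl ℝ _ _
  have he : Function.Injective e :=
    (LinearEquiv.sumArrowLequivProdArrow m k ℝ ℝ).symm.injective.comp LinearMap.inl_injective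
  have he_inr (u : m → ℝ) (i : k) : e u (Sum.inr i) = 0 := rfl
  have hle : LinearMap.range e ≤
      LinearMap.ker (Matrix.toLin' (fromBlocks (0 : Matrix m m ℝ) 0 0 A)) := by
    rintro _ ⟨u, rfl⟩
    have hu : e u ∘ Sum.inr = 0 := funext (he_inr u)
    simp [fromBlocks_mulVec, hu]
  have heq := Submodule.eq_of_le_of_finrank_eq hle
    (by rw [LinearMap.finrank_range_of_inj he, hker, Module.finrank_fintype_fun_eq_card])
  have hmem : Sum.elim (0 : m → ℝ) x ∈ LinearMap.range e := by
    rw [heq]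
    simp [fromBlocks_mulVec, hx]
  obtain ⟨u, hu⟩ := hmem
  ext i
  simpa [he_inr] using (congrFun hu (Sum.inr i)).symm

/-- **Definiteness of the lower-right block of the symmetrized relaxation term**
(Section 2 of the paper).  If `S = [[S11, S12],[S12ᵀ, S22]]` is symmetric, `q` is
invertible, `S·dQ` is symmetric with `dQ = [[0,0],[0,q]]`, `Re(S·dQ)` is negative
semidefinite and its kernel has dimension exactly `n`, then `S22·q` is symmetric
negative definite. -/
theorem S22q_negative_definite
    (n r : ℕ) (hn : 0 < n) (hr : 0 < r)
    (S11 : Matrix (Fin n) (Fin n) ℝ) (S12 : Matrix (Fin n) (Fin r) ℝ)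
    (S22 : Matrix (Fin r) (Fin r) ℝ)
    (q : Matrix (Fin r) (Fin r) ℝ) (hq : IsUnit q)
    (S : Matrix (Fin n ⊕ Fin r) (Fin n ⊕ Fin r) ℝ)
    (hS : S = Matrix.fromBlocks S11 S12 S12ᵀ S22)
    (hSsymm : S.IsSymm)
    (dQ : Matrix (Fin n ⊕ Fin r) (Fin n ⊕ Fin r) ℝ)
    (hdQ : dQ = Matrix.fromBlocks 0 0 0 q)
    (hSdQ : (S * dQ).IsSymm)
    (hneg : ∀ x : Fin n ⊕ Fin r → ℝ, x ⬝ᵥ (reMat (S * dQ)) *ᵥ x ≤ 0)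
    (hker : Module.finrank ℝ (LinearMap.ker (Matrix.toLin' (reMat (S * dQ)))) = n) :
    (S22 * q).IsSymm ∧ ∀ x : Fin r → ℝ, x ≠ 0 → x ⬝ᵥ (S22 * q) *ᵥ x < 0 := by
  have hprod : S * dQ = fromBlocks 0 (S12 * q) 0 (S22 * q) := by
    rw [hS, hdQ, fromBlocks_multiply]
    simp
  have hblocks := hSdQ
  rw [hprod, isSymm_fromBlocks_iff] at hblocks
  obtain ⟨-, -, hoff, hsymm⟩ := hblocks
  rw [transpose_zero] at hoff
  rw [reMat_eq_self hSdQ, hprod, ← hoff] at hneg hker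
  have hnonpos (x : Fin r → ℝ) : x ⬝ᵥ (S22 * q) *ᵥ x ≤ 0 := by
    simpa [fromBlocks_mulVec] using hneg (Sum.elim 0 x)
  have hpos : (-(S22 * q)).PosSemidef := by
    refine .of_dotProduct_mulVec_nonneg ?_ fun x => ?_
    · simpa [IsHermitian, conjTranspose_eq_transpose_of_trivial] using hsymm.eq
    · simpa [neg_mulVec] using hnonpos x
  refine ⟨hsymm, fun x hx => (hnonpos x).lt_of_ne fun hzero => hx ?_⟩
  have hAx := (hpos.dotProduct_mulVec_zero_iff x).1 (by simpa [neg_mulVec] using hzero)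
  rw [neg_mulVec, neg_eq_zero] at hAx
  exact eq_zero_of_mulVec_eq_zero_of_finrank_ker_fromBlocks (m := Fin n)
    (by simpa using hker) hAx
end

section
/- Let n, r be positive integers. Let S11 be an n×n symmetric positive definite real matrix, S22 an r×r symmetric positive definite real matrix, q an r×r real matrix such that S22·q is symmetric negative definite (in particular q is invertible), and let A12 (size n×r) and A21 (size r×n) be real matrices satisfying (S11·A12)ᵀ = S22·A21. Define b := −A12·q⁻¹·A21 (an n×n real matrix). Then: (i) S11·b is symmetric positive semidefinite; (ii) for every x ∈ ℝⁿ, the conditions b·x = 0, S11·b·x = 0, and A21·x = 0 are equivalent; in particular ker b = ker(S11·b) = ker A21 and dim ker Re(S11·b) = dim ker b. -/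
open Matrix

theorem reMat_eq_self_of_isSymm {ι : Type*} {M : Matrix ι ι ℝ} (hM : M.IsSymm) :
    reMat M = M := by
  rw [reMat, hM.eq, ← two_smul ℝ M, smul_smul]
  norm_num

/-- A real symmetric matrix whose quadratic form is negative off zero has positive definite
negation. -/
theorem posDef_neg_of_isSymm_of_neg {ι : Type*} [Fintype ι] {N : Matrix ι ι ℝ} (hN : N.IsSymm)
    (hneg : ∀ x : ι → ℝ, x ≠ 0 → x ⬝ᵥ N *ᵥ x < 0) : (-N).PosDef := by
  refine PosDef.of_dotProduct_mulVec_pos ?_ fun x hx => ?_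
  · rw [IsHermitian, conjTranspose_eq_transpose_of_trivial, transpose_neg, hN.eq]
  · simpa [neg_mulVec] using hneg x hx

theorem dotProduct_transpose_mul_mul_mulVec {ι κ : Type*} [Fintype ι] [Fintype κ]
    (B : Matrix κ ι ℝ) (P : Matrix κ κ ℝ) (x : ι → ℝ) :
    x ⬝ᵥ (Bᵀ * P * B) *ᵥ x = (B *ᵥ x) ⬝ᵥ P *ᵥ (B *ᵥ x) := by
  rw [← mulVec_mulVec, ← mulVec_mulVec, dotProduct_mulVec x, vecMul_transpose]

/-- **Yong's observation / core of Proposition 2.1 of the paper.**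
If `S11`, `S22` are symmetric positive definite, `S22·q` is symmetric negative
definite, and `(S11·A12)ᵀ = S22·A21`, then `b := −A12·q⁻¹·A21` satisfies:
(i) `S11·b` is symmetric positive semidefinite;
(ii) for every `x`, the conditions `b·x = 0`, `S11·b·x = 0` and `A21·x = 0`
are equivalent; in particular `dim ker Re(S11·b) = dim ker b`. -/
theorem reduced_viscosity_symmetrizable_dissipative
    (n r : ℕ) (hn : 0 < n) (hr : 0 < r)
    (S11 : Matrix (Fin n) (Fin n) ℝ) (S22 : Matrix (Fin r) (Fin r) ℝ)
    (q : Matrix (Fin r) (Fin r) ℝ)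
    (A12 : Matrix (Fin n) (Fin r) ℝ) (A21 : Matrix (Fin r) (Fin n) ℝ)
    (hS11symm : S11.IsSymm)
    (hS11pos : ∀ x : Fin n → ℝ, x ≠ 0 → 0 < x ⬝ᵥ S11 *ᵥ x)
    (hS22symm : S22.IsSymm)
    (hS22pos : ∀ x : Fin r → ℝ, x ≠ 0 → 0 < x ⬝ᵥ S22 *ᵥ x)
    (hS22qsymm : (S22 * q).IsSymm)
    (hS22qneg : ∀ x : Fin r → ℝ, x ≠ 0 → x ⬝ᵥ (S22 * q) *ᵥ x < 0)
    (hcompat : (S11 * A12)ᵀ = S22 * A21)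
    (b : Matrix (Fin n) (Fin n) ℝ)
    (hb : b = -(A12 * q⁻¹ * A21)) :
    ((S11 * b).IsSymm ∧ ∀ x : Fin n → ℝ, 0 ≤ x ⬝ᵥ (S11 * b) *ᵥ x) ∧
    (∀ x : Fin n → ℝ,
      (b *ᵥ x = 0 ↔ A21 *ᵥ x = 0) ∧ ((S11 * b) *ᵥ x = 0 ↔ A21 *ᵥ x = 0)) ∧
    Module.finrank ℝ (LinearMap.ker (Matrix.toLin' (reMat (S11 * b)))) =
      Module.finrank ℝ (LinearMap.ker (Matrix.toLin' b)) := by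
  have hP : (-(S22 * q)).PosDef := posDef_neg_of_isSymm_of_neg hS22qsymm hS22qneg
  have hq : IsUnit q.det := by
    have h := (isUnit_iff_isUnit_det _).1 hP.isUnit.neg
    rw [neg_neg, det_mul] at h
    exact isUnit_of_mul_isUnit_right h
  set B := q⁻¹ * A21 with hB
  have hqB : q * B = A21 := mul_nonsing_inv_cancel_left q A21 hq
  have hSA : S11 * A12 = A21ᵀ * S22 := by
    rw [← transpose_transpose (S11 * A12), hcompat, transpose_mul, hS22symm.eq]
  have hSb : S11 * b = Bᵀ * -(S22 * q) * B := by
    have hcomm : S22 * q = qᵀ * S22 := by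
      rw [← hS22qsymm.eq, transpose_mul, hS22symm.eq]
    rw [hcomm, hb, Matrix.mul_assoc A12, ← hB,
      Matrix.mul_neg, ← Matrix.mul_assoc, hSA, Matrix.mul_neg, Matrix.neg_mul,
      ← Matrix.mul_assoc Bᵀ, ← transpose_mul, hqB]
  have hsymm : (S11 * b).IsSymm := by
    rw [IsSymm, hSb]
    simp only [transpose_mul Bᵀ, transpose_mul _ B, transpose_neg, transpose_transpose,
      hS22qsymm.eq, Matrix.mul_assoc]
  have hform (x : Fin n → ℝ) :
      x ⬝ᵥ (S11 * b) *ᵥ x = (B *ᵥ x) ⬝ᵥ -(S22 * q) *ᵥ (B *ᵥ x) := by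
    rw [hSb, dotProduct_transpose_mul_mul_mulVec]
  have hker_of_form (x : Fin n → ℝ) (hx : (S11 * b) *ᵥ x = 0) : A21 *ᵥ x = 0 := by
    have hBx : B *ᵥ x = 0 := by
      by_contra hne
      have hpos := hP.dotProduct_mulVec_pos hne
      rw [star_trivial, ← hform, hx, dotProduct_zero] at hpos
      exact hpos.false
    rw [← hqB, ← mulVec_mulVec, hBx, mulVec_zero]
  have hb_of_A21 (x : Fin n → ℝ) (hx : A21 *ᵥ x = 0) : b *ᵥ x = 0 := by
    rw [hb, neg_mulVec, ← mulVec_mulVec, hx, mulVec_zero, neg_zero]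
  have hSb_of_b (x : Fin n → ℝ) (hx : b *ᵥ x = 0) : (S11 * b) *ᵥ x = 0 := by
    rw [← mulVec_mulVec, hx, mulVec_zero]
  refine ⟨⟨hsymm, fun x => ?_⟩, fun x => ⟨⟨fun h => hker_of_form x (hSb_of_b x h), hb_of_A21 x⟩,
    hker_of_form x, fun h => hSb_of_b x (hb_of_A21 x h)⟩, ?_⟩
  · rw [hform]
    exact hP.posSemidef.dotProduct_mulVec_nonneg (B *ᵥ x)
  · have hker : LinearMap.ker (toLin' (S11 * b)) = LinearMap.ker (toLin' b) := by
      ext x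
      simp only [LinearMap.mem_ker, toLin'_apply]
      exact ⟨fun h => hb_of_A21 x (hker_of_form x h), hSb_of_b x⟩
    rw [reMat_eq_self_of_isSymm hsymm, hker]
end

section
/- Assume the system data (see context) and fix K ∈ ℕ, θ > 0, C₀ > 0, ρ₀ > 0 with the closed ball of radius ρ₀ about (u₀,0) contained in 𝒰. Then there exist ε₀ > 0 and C > 0, depending only on f, q, A21, A22, u₀, ρ₀, θ, C₀ and K, such that the following holds. Let u₋, u₊ ∈ ℝⁿ with |u₋ − u₀| ≤ ρ₀/2, |u₊ − u₀| ≤ ρ₀/2, f_*(u₊) = f_*(u₋), and ε := |u₊ − u₋| ∈ (0, ε₀]. Let ū : ℝ → ℝⁿ be a C^∞ function with values in the ball of radius ρ₀ about u₀, satisfying b_*(ū)·ū' = f_*(ū) − f_*(u₋) on ℝ, lim_{x→−∞} ū(x) = u₋, lim_{x→+∞} ū(x) = u₊, and |∂_x^k(ū(x) − u₊)| ≤ C₀ ε^{k+1} e^{−θε|x|} for x ≥ 0 and |∂_x^k(ū(x) − u₋)| ≤ C₀ ε^{k+1} e^{−θε|x|} for x ≤ 0, for all 0 ≤ k ≤ K+2.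 Define v̄ := c_*(ū)·ū', R_u := f(ū, v̄) − f_*(u₋), and R_v := A21(ū, v̄)·ū' + A22(ū, v̄)·v̄' − q(ū, v̄). Then for all 0 ≤ k ≤ K and all x ∈ ℝ: |∂_x^k R_u(x)| ≤ C ε^{k+4} e^{−θε|x|} and |∂_x^k R_v(x)| ≤ C ε^{k+3} e^{−θε|x|}. -/
open MeasureTheory Filter Metric Set

noncomputable section

/-- Euclidean state space. -/
abbrev Eu (n : ℕ) := EuclideanSpace ℝ (Fin n)

/-- Partial derivative with respect to the second (kinetic) variable, at `(u,0)`. -/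
def Dv {n r m : ℕ} (F : Eu n × Eu r → Eu m) (u : Eu n) : Eu r →L[ℝ] Eu m :=
  (fderiv ℝ F (u, 0)).comp (ContinuousLinearMap.inr ℝ (Eu n) (Eu r))

/-- Equilibrium flux `f_*(u) = f(u,0)`. -/
def fstar {n r : ℕ} (f : Eu n × Eu r → Eu n) (u : Eu n) : Eu n := f (u, 0)

/-- `c_*(u) = (D_v q(u,0))⁻¹ · A21(u,0)`. -/
def cstar {n r : ℕ} (q : Eu n × Eu r → Eu r)
    (A21 : Eu n × Eu r → (Eu n →L[ℝ] Eu r)) (u : Eu n) : Eu n →L[ℝ] Eu r :=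
  ((Dv q u).inverse).comp (A21 (u, 0))

/-- `b_*(u) = −D_v f(u,0) · (D_v q(u,0))⁻¹ · A21(u,0)`. -/
def bstar {n r : ℕ} (f : Eu n × Eu r → Eu n) (q : Eu n × Eu r → Eu r)
    (A21 : Eu n × Eu r → (Eu n →L[ℝ] Eu r)) (u : Eu n) : Eu n →L[ℝ] Eu n :=
  -((Dv f u).comp (cstar q A21 u))

open scoped ContDiff

section ScaledBound

variable {ι E F G : Type*} [NormedAddCommGroup E] [NormedSpace ℝ E]
  [NormedAddCommGroup F] [NormedSpace ℝ F] [NormedAddCommGroup G] [NormedSpace ℝ G]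

/-- A family of smooth curves `g i : ℝ → E` whose derivatives up to order `N` satisfy
`‖∂ᵏ (g i)‖ ≤ B (ε i)ᵏ w i` with a constant `B` independent of `i`. -/
def ScaledBound (N : ℕ) (ε : ι → ℝ) (w : ι → ℝ → ℝ) (g : ι → ℝ → E) : Prop :=
  (∀ i, ContDiff ℝ ∞ (g i)) ∧
    ∃ B : ℝ, 0 ≤ B ∧ ∀ i, ∀ k ≤ N, ∀ x, ‖iteratedDeriv k (g i) x‖ ≤ B * ε i ^ k * w i x

namespace ScaledBound

variable {N : ℕ} {ε : ι → ℝ} {w w₁ w₂ : ι → ℝ → ℝ} {g g₁ g₂ : ι → ℝ → E}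

theorem of_le (h : ScaledBound N ε w g) {M : ℕ} (hM : M ≤ N) : ScaledBound M ε w g := by
  obtain ⟨hs, B, hB, hb⟩ := h
  exact ⟨hs, B, hB, fun i k hk => hb i k (hk.trans hM)⟩

theorem mono (h : ScaledBound N ε w₁ g) (hε : ∀ i, 0 ≤ ε i)
    (hw : ∀ i x, w₁ i x ≤ w₂ i x) : ScaledBound N ε w₂ g := by
  obtain ⟨hs, B, hB, hb⟩ := h
  refine ⟨hs, B, hB, fun i k hk x => (hb i k hk x).trans ?_⟩
  have := hε i
  have := hw i x
  gcongr

theorem congr (h : ScaledBound N ε w g₁) (heq : ∀ i x, g₂ i x = g₁ i x) :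
    ScaledBound N ε w g₂ := by
  rwa [show g₂ = g₁ from funext fun i => funext (heq i)]

theorem reindex {κ : Type*} (h : ScaledBound N ε w g) (φ : κ → ι) :
    ScaledBound N (fun j => ε (φ j)) (fun j => w (φ j)) (fun j => g (φ j)) := by
  obtain ⟨hs, B, hB, hb⟩ := h
  exact ⟨fun j => hs _, B, hB, fun j => hb _⟩

theorem add (h₁ : ScaledBound N ε w g₁) (h₂ : ScaledBound N ε w g₂) :
    ScaledBound N ε w (fun i x => g₁ i x + g₂ i x) := by
  obtain ⟨hs₁, B₁, hB₁, hb₁⟩ := h₁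
  obtain ⟨hs₂, B₂, hB₂, hb₂⟩ := h₂
  refine ⟨fun i => (hs₁ i).add (hs₂ i), B₁ + B₂, add_nonneg hB₁ hB₂, fun i k hk x => ?_⟩
  have hk' : (k : WithTop ℕ∞) ≤ ∞ := by exact_mod_cast le_top
  rw [iteratedDeriv_fun_add ((hs₁ i).contDiffAt.of_le hk') ((hs₂ i).contDiffAt.of_le hk')]
  calc _ ≤ _ := norm_add_le _ _
    _ ≤ _ := add_le_add (hb₁ i k hk x) (hb₂ i k hk x)
    _ = _ := by ring

theorem bilinear (L : E →L[ℝ] F →L[ℝ] G) {g₂ : ι → ℝ → F} (hε : ∀ i, 0 ≤ ε i)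
    (hw₁ : ∀ i x, 0 ≤ w₁ i x) (h₁ : ScaledBound N ε w₁ g₁) (h₂ : ScaledBound N ε w₂ g₂) :
    ScaledBound N ε (fun i x => w₁ i x * w₂ i x) (fun i x => L (g₁ i x) (g₂ i x)) := by
  obtain ⟨hs₁, B₁, hB₁, hb₁⟩ := h₁
  obtain ⟨hs₂, B₂, hB₂, hb₂⟩ := h₂
  refine ⟨fun i => L.isBoundedBilinearMap.contDiff.comp ((hs₁ i).prodMk (hs₂ i)),
    ‖L‖ * (2 ^ N * (B₁ * B₂)), by positivity, fun i k hk x => ?_⟩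
  have hk' : (k : WithTop ℕ∞) ≤ ∞ := by exact_mod_cast le_top
  have hw₂ : 0 ≤ B₂ * w₂ i x := by
    simpa using (norm_nonneg _).trans (hb₂ i 0 (Nat.zero_le _) x)
  have hεi := hε i
  have hw := hw₁ i x
  rw [← norm_iteratedFDeriv_eq_norm_iteratedDeriv]
  calc _ ≤ _ := L.norm_iteratedFDeriv_le_of_bilinear (hs₁ i) (hs₂ i) x hk'
    _ ≤ ‖L‖ * ∑ j ∈ Finset.range (k + 1),
          (k.choose j : ℝ) * (B₁ * B₂ * ε i ^ k * (w₁ i x * w₂ i x)) := by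
      refine mul_le_mul_of_nonneg_left (Finset.sum_le_sum fun j hj => ?_) (norm_nonneg L)
      have hj' : j ≤ k := Nat.lt_succ_iff.1 (Finset.mem_range.1 hj)
      rw [norm_iteratedFDeriv_eq_norm_iteratedDeriv, norm_iteratedFDeriv_eq_norm_iteratedDeriv,
        mul_assoc]
      refine mul_le_mul_of_nonneg_left ?_ (Nat.cast_nonneg _)
      calc _ ≤ (B₁ * ε i ^ j * w₁ i x) * (B₂ * ε i ^ (k - j) * w₂ i x) :=
            mul_le_mul (hb₁ i j (hj'.trans hk) x) (hb₂ i (k - j) ((Nat.sub_le _ _).trans hk) x)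
              (norm_nonneg _) (by positivity)
        _ = B₁ * B₂ * (ε i ^ j * ε i ^ (k - j)) * (w₁ i x * w₂ i x) := by ring
        _ = _ := by rw [← pow_add, Nat.add_sub_cancel' hj']
    _ = ‖L‖ * (2 ^ k * (B₁ * ε i ^ k * w₁ i x * (B₂ * w₂ i x))) := by
      rw [← Finset.sum_mul, ← Nat.cast_sum, Nat.sum_range_choose]
      push_cast
      ring
    _ ≤ ‖L‖ * (2 ^ N * (B₁ * ε i ^ k * w₁ i x * (B₂ * w₂ i x))) := by
      gcongr
      norm_num
    _ = _ := by ring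

theorem clm_apply {A : ι → ℝ → E →L[ℝ] F} (hε : ∀ i, 0 ≤ ε i)
    (hw₁ : ∀ i x, 0 ≤ w₁ i x) (h₁ : ScaledBound N ε w₁ A) (h₂ : ScaledBound N ε w₂ g) :
    ScaledBound N ε (fun i x => w₁ i x * w₂ i x) (fun i x => A i x (g i x)) :=
  bilinear (ContinuousLinearMap.id ℝ (E →L[ℝ] F)) hε hw₁ h₁ h₂

theorem const_clm (L : E →L[ℝ] F) (h : ScaledBound N ε w g) :
    ScaledBound N ε w (fun i x => L (g i x)) := by
  obtain ⟨hs, B, hB, hb⟩ := h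
  refine ⟨fun i => L.contDiff.comp (hs i), ‖L‖ * B, by positivity, fun i k hk x => ?_⟩
  have hk' : (k : WithTop ℕ∞) ≤ ∞ := by exact_mod_cast le_top
  rw [← norm_iteratedFDeriv_eq_norm_iteratedDeriv]
  have := L.norm_iteratedFDeriv_comp_left (hs i).contDiffAt hk' (x := x)
  rw [norm_iteratedFDeriv_eq_norm_iteratedDeriv (f := g i)] at this
  calc _ ≤ _ := this
    _ ≤ ‖L‖ * (B * ε i ^ k * w i x) := by gcongr; exact hb i k hk x
    _ = _ := by ring

theorem neg (h : ScaledBound N ε w g) : ScaledBound N ε w (fun i x => -g i x) :=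
  h.const_clm (-ContinuousLinearMap.id ℝ E)

protected theorem deriv (h : ScaledBound (N + 1) ε w g) :
    ScaledBound N ε (fun i x => ε i * w i x) (fun i => deriv (g i)) := by
  obtain ⟨hs, B, hB, hb⟩ := h
  refine ⟨fun i => (contDiff_infty_iff_deriv.1 (hs i)).2, B, hB, fun i k hk x => ?_⟩
  rw [← iteratedDeriv_succ']
  calc _ ≤ _ := hb i (k + 1) (by lia) x
    _ = _ := by ring

theorem of_deriv (hε : ∀ i, 0 ≤ ε i) (hw : ∀ i x, 0 ≤ w i x) (h₀ : ScaledBound 0 ε w g)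
    (h : ScaledBound N ε (fun i x => ε i * w i x) (fun i => deriv (g i))) :
    ScaledBound (N + 1) ε w g := by
  obtain ⟨hs, B₀, hB₀, hb₀⟩ := h₀
  obtain ⟨-, B, hB, hb⟩ := h
  refine ⟨hs, B₀ + B, by positivity, fun i k hk x => ?_⟩
  have := hε i
  have := hw i x
  rcases k with _ | k
  · calc _ ≤ _ := hb₀ i 0 le_rfl x
      _ ≤ _ := by gcongr; linarith
  · rw [iteratedDeriv_succ']
    calc _ ≤ _ := hb i k (by lia) x
      _ = B * ε i ^ (k + 1) * w i x := by ring
      _ ≤ _ := by gcongr; linarith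

theorem comp {H : E → F} {U K : Set E} (hU : IsOpen U) (hK : IsCompact K) (hKU : K ⊆ U)
    (hH : ContDiffOn ℝ ∞ H U) (hgK : ∀ i x, g i x ∈ K) (hε : ∀ i, 0 ≤ ε i)
    (h : ScaledBound N ε (fun _ _ => 1) g) :
    ScaledBound N ε (fun _ _ => 1) (fun i x => H (g i x)) := by
  obtain ⟨hs, B, hB, hb⟩ := h
  have hbound : ∀ k : ℕ, ∃ c, ∀ p ∈ K, ‖iteratedFDerivWithin ℝ k H U p‖ ≤ c := fun k =>
    hK.exists_bound_of_continuousOn ((hH.continuousOn_iteratedFDerivWithin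
      (by exact_mod_cast le_top) hU.uniqueDiffOn).mono hKU)
  choose c hc using hbound
  have hsum : ∀ k ≤ N, ∀ p ∈ K,
      ‖iteratedFDerivWithin ℝ k H U p‖ ≤ ∑ j ∈ Finset.range (N + 1), |c j| := fun k hk p hp =>
    ((hc k p hp).trans (le_abs_self _)).trans
      (Finset.single_le_sum (f := fun j => |c j|) (fun _ _ => abs_nonneg _)
        (Finset.mem_range.2 (by lia)))
  refine ⟨fun i => hH.comp_contDiff (hs i) fun x => hKU (hgK i x),
    N.factorial * (∑ j ∈ Finset.range (N + 1), |c j|) * (B + 1) ^ N, by positivity,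
    fun i k hk x => ?_⟩
  have hεi := hε i
  have key := norm_iteratedFDerivWithin_comp_le (n := k) (x := x) (D := (B + 1) * ε i) hH
    (hs i).contDiffOn (by exact_mod_cast le_top) hU.uniqueDiffOn uniqueDiffOn_univ
    (fun y _ => hKU (hgK i y)) (mem_univ x) (fun j hj => hsum j (hj.trans hk) _ (hgK i x))
    (fun j hj hjk => by
      rw [iteratedFDerivWithin_univ, norm_iteratedFDeriv_eq_norm_iteratedDeriv, mul_pow]
      calc _ ≤ _ := hb i j (hjk.trans hk) x
        _ = B * ε i ^ j := mul_one _
        _ ≤ _ := by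
          gcongr
          calc B ≤ B + 1 := by linarith
            _ ≤ (B + 1) ^ j := le_self_pow₀ (by linarith) (by lia))
  rw [iteratedFDerivWithin_univ, norm_iteratedFDeriv_eq_norm_iteratedDeriv] at key
  calc _ ≤ _ := key
    _ = k.factorial * (∑ j ∈ Finset.range (N + 1), |c j|) * (B + 1) ^ k * ε i ^ k := by
      rw [mul_pow, mul_assoc _ (_ ^ k)]
    _ ≤ N.factorial * (∑ j ∈ Finset.range (N + 1), |c j|) * (B + 1) ^ N * ε i ^ k := by
      gcongr
      linarith
    _ = _ := (mul_one _).symm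

end ScaledBound

end ScaledBound

section TaylorRemainder

universe u

variable {X Y E : Type u} [NormedAddCommGroup X] [NormedSpace ℝ X]
  [NormedAddCommGroup Y] [NormedSpace ℝ Y] [NormedAddCommGroup E] [NormedSpace ℝ E]

theorem Convex.norm_sub_sub_fderiv_le {s : Set X} (hs : Convex ℝ s) {f : X → E} {M : ℝ}
    (hf : ∀ p ∈ s, DifferentiableAt ℝ f p) (hf' : ∀ p ∈ s, DifferentiableAt ℝ (fderiv ℝ f) p)
    (hM : ∀ p ∈ s, ‖fderiv ℝ (fderiv ℝ f) p‖ ≤ M) {x y : X} (hx : x ∈ s) (hy : y ∈ s) :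
    ‖f y - f x - fderiv ℝ f x (y - x)‖ ≤ M * ‖y - x‖ ^ 2 := by
  have hM0 : 0 ≤ M := (norm_nonneg (fderiv ℝ (fderiv ℝ f) x)).trans (hM x hx)
  have hseg : segment ℝ x y ⊆ s := hs.segment_subset hx hy
  have := (convex_segment x y).norm_image_sub_le_of_norm_fderiv_le' (φ := fderiv ℝ f x)
    (C := M * ‖y - x‖) (fun p hp => hf p (hseg hp))
    (fun p hp => (hs.norm_image_sub_le_of_norm_fderiv_le hf' hM hx (hseg hp)).trans
      (mul_le_mul_of_nonneg_left (norm_sub_le_of_mem_segment hp) hM0))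
    (left_mem_segment ℝ x y) (right_mem_segment ℝ x y)
  rwa [mul_assoc, ← sq] at this

/-- Projection of `X × Y` onto `X × {0}`. -/
def toEquilibrium (X Y : Type u) [NormedAddCommGroup X] [NormedSpace ℝ X]
    [NormedAddCommGroup Y] [NormedSpace ℝ Y] : X × Y →L[ℝ] X × Y :=
  (ContinuousLinearMap.inl ℝ X Y).comp (ContinuousLinearMap.fst ℝ X Y)

/-- Projection of `X × Y` onto `{0} × Y`. -/
def toKinetic (X Y : Type u) [NormedAddCommGroup X] [NormedSpace ℝ X]
    [NormedAddCommGroup Y] [NormedSpace ℝ Y] : X × Y →L[ℝ] X × Y :=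
  (ContinuousLinearMap.inr ℝ X Y).comp (ContinuousLinearMap.snd ℝ X Y)

local notation "πₑ" => toEquilibrium X Y
local notation "πₖ" => toKinetic X Y

theorem toKinetic_eq_sub (p : X × Y) : πₖ p = p - πₑ p := by
  ext <;> simp [toKinetic, toEquilibrium]

variable {ι : Type*} {U K : Set (X × Y)} {z : ι → ℝ → X × Y} {N : ℕ} {ε : ι → ℝ}
  {w : ι → ℝ → ℝ} {f : X × Y → E}

theorem ContDiffOn.hasDerivAt_comp (hU : IsOpen U) (hf : ContDiffOn ℝ ∞ f U)
    {c : ℝ → X × Y} (hc : ContDiff ℝ ∞ c) {x : ℝ} (hx : c x ∈ U) :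
    HasDerivAt (fun y => f (c y)) (fderiv ℝ f (c x) (deriv c x)) x :=
  ((hf.contDiffAt (hU.mem_nhds hx)).differentiableAt (by simp)).hasFDerivAt.comp_hasDerivAt x
    ((hc.differentiable (by simp)) x).hasDerivAt

theorem ContinuousLinearMap.deriv_comp_contDiff (L : X →L[ℝ] E) {c : ℝ → X} (hc : ContDiff ℝ ∞ c)
    (x : ℝ) : deriv (fun y => L (c y)) x = L (deriv c x) :=
  (L.hasFDerivAt.comp_hasDerivAt x ((hc.differentiable (by simp)) x).hasDerivAt).deriv

/-- The first-order remainder `f(u,v) - f(u,0)` along a family of curves is as small as `v`. -/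
theorem ScaledBound.sub_equilibrium (hU : IsOpen U) (hK : IsCompact K) (hKU : K ⊆ U)
    (hKc : Convex ℝ K) (hKe : ∀ p ∈ K, πₑ p ∈ K) (hzK : ∀ i x, z i x ∈ K)
    (hε : ∀ i, 0 ≤ ε i) (hw : ∀ i x, 0 ≤ w i x)
    (hz : ScaledBound N ε (fun _ _ => 1) z) (hv : ScaledBound N ε w (fun i x => πₖ (z i x)))
    (hf : ContDiffOn ℝ ∞ f U) :
    ScaledBound N ε w (fun i x => f (z i x) - f (πₑ (z i x))) := by
  have hze := hz.const_clm πₑ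
  have hzU : ∀ i x, z i x ∈ U := fun i x => hKU (hzK i x)
  have hzeK : ∀ i x, πₑ (z i x) ∈ K := fun i x => hKe _ (hzK i x)
  have hzeU : ∀ i x, πₑ (z i x) ∈ U := fun i x => hKU (hzeK i x)
  induction N generalizing E with
  | zero =>
    obtain ⟨M, hM⟩ := hK.exists_bound_of_continuousOn
      ((hf.continuousOn_fderiv_of_isOpen hU (by simp)).mono hKU)
    obtain ⟨-, B, hB, hb⟩ := hv
    refine ⟨fun i => (hf.comp_contDiff (hz.1 i) (hzU i)).sub
      (hf.comp_contDiff (hze.1 i) (hzeU i)), |M| * B, by positivity, fun i k hk x => ?_⟩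
    obtain rfl : k = 0 := by lia
    have h0 := hb i 0 le_rfl x
    have h1 := hKc.norm_image_sub_le_of_norm_fderiv_le
      (fun p hp => (hf.contDiffAt (hU.mem_nhds (hKU hp))).differentiableAt (by simp))
      hM (hzeK i x) (hzK i x)
    rw [← toKinetic_eq_sub] at h1
    simp only [iteratedDeriv_zero, pow_zero, mul_one] at h0 ⊢
    calc _ ≤ _ := h1
      _ ≤ |M| * (B * w i x) := by gcongr; exact le_abs_self M
      _ = _ := by ring
  | succ N ih =>
    have hdf : ContDiffOn ℝ ∞ (fderiv ℝ f) U := hf.fderiv_of_isOpen hU (by simp)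
    have hN : N ≤ N + 1 := N.le_succ
    refine .of_deriv hε hw ?_ ?_
    · have := ih (hz.of_le hN) (hv.of_le hN) hf (hze.of_le hN)
      exact this.of_le N.zero_le
    · have h₁ := (ih (hz.of_le hN) (hv.of_le hN) hdf (hze.of_le hN)).clm_apply hε hw hz.deriv
      have h₂ := ((hze.of_le hN).comp hU hK hKU hdf hzeK hε).clm_apply hε
        (fun _ _ => zero_le_one) hv.deriv
      refine (((h₁.mono hε fun i x => ?_).add (h₂.mono hε fun i x => ?_))).congr fun i x => ?_
      · exact (show w i x * (ε i * 1) = ε i * w i x by ring).le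
      · exact (one_mul _).le
      · refine ((hf.hasDerivAt_comp hU (hz.1 i) (hzU i x)).sub
          (hf.hasDerivAt_comp hU (hze.1 i) (hzeU i x))).deriv.trans ?_
        rw [ContinuousLinearMap.deriv_comp_contDiff _ (hz.1 i),
          ContinuousLinearMap.deriv_comp_contDiff _ (hz.1 i), toKinetic_eq_sub]
        simp

/-- The second-order remainder `f(u,v) - f(u,0) - D_vf(u,0) v` along a family of curves is as
small as `|v|²`. -/
theorem ScaledBound.sub_sub_equilibrium (hU : IsOpen U) (hK : IsCompact K) (hKU : K ⊆ U)
    (hKc : Convex ℝ K) (hKe : ∀ p ∈ K, πₑ p ∈ K) (hzK : ∀ i x, z i x ∈ K)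
    (hε : ∀ i, 0 ≤ ε i) (hw : ∀ i x, 0 ≤ w i x)
    (hz : ScaledBound N ε (fun _ _ => 1) z) (hv : ScaledBound N ε w (fun i x => πₖ (z i x)))
    (hf : ContDiffOn ℝ ∞ f U) :
    ScaledBound N ε (fun i x => w i x ^ 2)
      (fun i x => f (z i x) - f (πₑ (z i x)) - fderiv ℝ f (πₑ (z i x)) (πₖ (z i x))) := by
  have hze := hz.const_clm πₑ
  have hzU : ∀ i x, z i x ∈ U := fun i x => hKU (hzK i x)
  have hzeK : ∀ i x, πₑ (z i x) ∈ K := fun i x => hKe _ (hzK i x)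
  have hzeU : ∀ i x, πₑ (z i x) ∈ U := fun i x => hKU (hzeK i x)
  induction N generalizing E with
  | zero =>
    have hdf : ContDiffOn ℝ ∞ (fderiv ℝ f) U := hf.fderiv_of_isOpen hU (by simp)
    obtain ⟨M, hM⟩ := hK.exists_bound_of_continuousOn
      ((hdf.continuousOn_fderiv_of_isOpen hU (by simp)).mono hKU)
    obtain ⟨hvs, B, hB, hb⟩ := hv
    refine ⟨fun i => ((hf.comp_contDiff (hz.1 i) (hzU i)).sub
      (hf.comp_contDiff (hze.1 i) (hzeU i))).sub
        ((hdf.comp_contDiff (hze.1 i) (hzeU i)).clm_apply (hvs i)),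
      |M| * B ^ 2, by positivity, fun i k hk x => ?_⟩
    obtain rfl : k = 0 := by lia
    have h0 := hb i 0 le_rfl x
    have h1 := hKc.norm_sub_sub_fderiv_le
      (fun p hp => (hf.contDiffAt (hU.mem_nhds (hKU hp))).differentiableAt (by simp))
      (fun p hp => (hdf.contDiffAt (hU.mem_nhds (hKU hp))).differentiableAt (by simp))
      hM (hzeK i x) (hzK i x)
    rw [← toKinetic_eq_sub] at h1
    simp only [iteratedDeriv_zero, pow_zero, mul_one] at h0 ⊢
    calc _ ≤ _ := h1
      _ ≤ |M| * (B * w i x) ^ 2 := by gcongr; exact le_abs_self M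
      _ = _ := by ring
  | succ N ih =>
    have hdf : ContDiffOn ℝ ∞ (fderiv ℝ f) U := hf.fderiv_of_isOpen hU (by simp)
    have hddf : ContDiffOn ℝ ∞ (fderiv ℝ (fderiv ℝ f)) U := hdf.fderiv_of_isOpen hU (by simp)
    have hN : N ≤ N + 1 := N.le_succ
    refine .of_deriv hε (fun _ _ => sq_nonneg _) ?_ ?_
    · have := ih (hz.of_le hN) (hv.of_le hN) hf (hze.of_le hN)
      exact this.of_le N.zero_le
    · have h₁ := (ih (hz.of_le hN) (hv.of_le hN) hdf (hze.of_le hN)).clm_apply hε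
        (fun _ _ => sq_nonneg _) hz.deriv
      have h₂ := (((hze.of_le hN).comp hU hK hKU hddf hzeK hε).clm_apply hε
        (fun _ _ => zero_le_one) (hv.of_le hN)).clm_apply hε
          (fun i x => mul_nonneg zero_le_one (hw i x)) hv.deriv
      refine ((h₁.mono hε fun i x => ?_).add (h₂.mono hε fun i x => ?_)).congr fun i x => ?_
      · exact (show w i x ^ 2 * (ε i * 1) = ε i * w i x ^ 2 by ring).le
      · exact (show 1 * w i x * (ε i * w i x) = ε i * w i x ^ 2 by ring).le
      · have hsymm : IsSymmSndFDerivAt ℝ f (πₑ (z i x)) :=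
          (hf.contDiffAt (hU.mem_nhds (hzeU i x))).isSymmSndFDerivAt 
            (by simpa using WithTop.coe_le_coe.2 (le_top : (2 : ℕ∞) ≤ ⊤))
        refine (((hf.hasDerivAt_comp hU (hz.1 i) (hzU i x)).sub
          (hf.hasDerivAt_comp hU (hze.1 i) (hzeU i x))).sub
          ((hdf.hasDerivAt_comp hU (hze.1 i) (hzeU i x)).clm_apply
            (((hv.1 i).differentiable (by simp)) x).hasDerivAt)).deriv.trans ?_
        rw [ContinuousLinearMap.deriv_comp_contDiff _ (hz.1 i), ContinuousLinearMap.deriv_comp_contDiff _ (hz.1 i),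
          hsymm.eq (πₑ (deriv (z i) x)) (πₖ (z i x)), toKinetic_eq_sub (deriv (z i) x)]
        simp only [sub_apply, map_sub]
        abel

end TaylorRemainder

section System

variable {n r : ℕ}

theorem contDiffOn_cstar {U : Set (Eu n × Eu r)} (hU : IsOpen U) {q : Eu n × Eu r → Eu r}
    {A21 : Eu n × Eu r → (Eu n →L[ℝ] Eu r)} (hq : ContDiffOn ℝ ∞ q U)
    (hA21 : ContDiffOn ℝ ∞ A21 U)
    (he : ∀ u : Eu n, ((u, 0) : Eu n × Eu r) ∈ U →
      ∃ e : Eu r ≃L[ℝ] Eu r, (e : Eu r →L[ℝ] Eu r) = Dv q u) :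
    ContDiffOn ℝ ∞ (cstar q A21) {u | ((u, 0) : Eu n × Eu r) ∈ U} := by
  have hmaps : MapsTo (fun u : Eu n => ((u, 0) : Eu n × Eu r)) {u | ((u, 0) : Eu n × Eu r) ∈ U} U :=
    fun _ h => h
  have hin : ContDiff ℝ ∞ (fun u : Eu n => ((u, 0) : Eu n × Eu r)) := by fun_prop
  have hDv : ContDiffOn ℝ ∞ (Dv q) {u | ((u, 0) : Eu n × Eu r) ∈ U} :=
    ((hq.fderiv_of_isOpen hU (by simp)).comp hin.contDiffOn hmaps).clm_comp contDiffOn_const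
  refine ContDiffOn.clm_comp (fun u hu => ?_) (hA21.comp hin.contDiffOn hmaps)
  obtain ⟨e, hue⟩ := he u hu
  have hinv : ContDiffAt ℝ ∞ (ContinuousLinearMap.inverse : (Eu r →L[ℝ] Eu r) → _) (Dv q u) :=
    hue ▸ contDiffAt_map_inverse e
  exact hinv.comp_contDiffWithinAt u (hDv u hu)

theorem Dv_apply {m : ℕ} (F : Eu n × Eu r → Eu m) (u : Eu n) (v : Eu r) :
    Dv F u v = fderiv ℝ F (u, 0) (0, v) := by
  simp [Dv]

theorem Dv_cstar_apply {q : Eu n × Eu r → Eu r} {A21 : Eu n × Eu r → (Eu n →L[ℝ] Eu r)}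
    {u : Eu n} (he : ∃ e : Eu r ≃L[ℝ] Eu r, (e : Eu r →L[ℝ] Eu r) = Dv q u) (p : Eu n) :
    Dv q u (cstar q A21 u p) = A21 (u, 0) p := by
  obtain ⟨e, hue⟩ := he
  simp [cstar, ← hue]

theorem toEquilibrium_mem_closedBall {u₀ : Eu n} {ρ : ℝ} {p : Eu n × Eu r}
    (hp : p ∈ closedBall ((u₀, 0) : Eu n × Eu r) ρ) :
    toEquilibrium (Eu n) (Eu r) p ∈ closedBall ((u₀, 0) : Eu n × Eu r) ρ := by
  rw [← closedBall_prod_same] at hp ⊢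
  exact ⟨hp.1, by simpa [toEquilibrium] using dist_nonneg.trans hp.1⟩

variable {ι : Type*} {U : Set (Eu n × Eu r)} {u₀ : Eu n} {ρ : ℝ} {N : ℕ}
  {ε : ι → ℝ} {w : ι → ℝ → ℝ} {ub : ι → ℝ → Eu n} {vb : ι → ℝ → Eu r}

theorem ScaledBound.prodMk (hu : ScaledBound N ε w ub) (hv : ScaledBound N ε w vb) :
    ScaledBound N ε w (fun i x => (ub i x, vb i x)) :=
  ((hu.const_clm (ContinuousLinearMap.inl ℝ (Eu n) (Eu r))).add
    (hv.const_clm (ContinuousLinearMap.inr ℝ (Eu n) (Eu r)))).congr fun i x => by simp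

theorem ScaledBound.of_deriv_of_mem_closedBall (hε : ∀ i, 0 ≤ ε i)
    (hs : ∀ i, ContDiff ℝ ∞ (ub i)) (hball : ∀ i x, ‖ub i x - u₀‖ ≤ ρ)
    (h : ScaledBound N ε (fun i _ => ε i) (fun i => deriv (ub i))) :
    ScaledBound (N + 1) ε (fun _ _ => 1) ub := by
  refine .of_deriv hε (fun _ _ => zero_le_one) ⟨hs, |ρ| + ‖u₀‖, by positivity, ?_⟩
    (h.mono hε fun i _ => (mul_one _).ge)
  intro i k hk x
  obtain rfl : k = 0 := by lia
  have := norm_le_norm_sub_add (ub i x) u₀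
  have := hball i x
  have := le_abs_self ρ
  simp only [iteratedDeriv_zero, pow_zero, mul_one]
  linarith

/-- The kinetic residual of a Chapman–Enskog profile, where `w` controls `u'` and `v`. -/
theorem ScaledBound.kinetic_residual (hU : IsOpen U)
    (hball : closedBall ((u₀, 0) : Eu n × Eu r) ρ ⊆ U)
    {q : Eu n × Eu r → Eu r} {A21 : Eu n × Eu r → (Eu n →L[ℝ] Eu r)}
    {A22 : Eu n × Eu r → (Eu r →L[ℝ] Eu r)} (hq : ContDiffOn ℝ ∞ q U)
    (hA21 : ContDiffOn ℝ ∞ A21 U) (hA22 : ContDiffOn ℝ ∞ A22 U)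
    (hq0 : ∀ u : Eu n, ((u, 0) : Eu n × Eu r) ∈ U →
      q (u, 0) = 0 ∧ ∃ e : Eu r ≃L[ℝ] Eu r, (e : Eu r →L[ℝ] Eu r) = Dv q u)
    (hzK : ∀ i x, (ub i x, vb i x) ∈ closedBall ((u₀, 0) : Eu n × Eu r) ρ)
    (hε : ∀ i, 0 ≤ ε i) (hw : ∀ i x, 0 ≤ w i x) (hwε : ∀ i x, w i x ≤ ε i)
    (hz : ScaledBound N ε (fun _ _ => 1) (fun i x => (ub i x, vb i x)))
    (hu : ScaledBound N ε w (fun i => deriv (ub i))) (hv : ScaledBound (N + 1) ε w vb)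
    (hvb : ∀ i x, vb i x = cstar q A21 (ub i x) (deriv (ub i) x)) :
    ScaledBound N ε (fun i x => ε i * w i x) (fun i x => A21 (ub i x, vb i x) (deriv (ub i) x)
      + A22 (ub i x, vb i x) (deriv (vb i) x) - q (ub i x, vb i x)) := by
  have hK := isCompact_closedBall ((u₀, 0) : Eu n × Eu r) ρ
  have hKc := convex_closedBall ((u₀, 0) : Eu n × Eu r) ρ
  have hKe : ∀ p ∈ closedBall ((u₀, 0) : Eu n × Eu r) ρ,
      toEquilibrium (Eu n) (Eu r) p ∈ closedBall ((u₀, 0) : Eu n × Eu r) ρ := fun p hp =>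
    toEquilibrium_mem_closedBall hp
  have hkin : ScaledBound N ε w (fun i x => toKinetic (Eu n) (Eu r) (ub i x, vb i x)) :=
    (hv.of_le N.le_succ).const_clm (ContinuousLinearMap.inr ℝ (Eu n) (Eu r))
  have h₁ := (ScaledBound.sub_equilibrium hU hK hball hKc hKe hzK hε hw hz hkin hA21).clm_apply
    hε hw hu
  have h₂ := (hz.comp hU hK hball hA22 hzK hε).clm_apply hε (fun _ _ => zero_le_one) hv.deriv
  have h₃ := ScaledBound.sub_sub_equilibrium hU hK hball hKc hKe hzK hε hw hz hkin hq
  have hsq : ∀ i x, w i x * w i x ≤ ε i * w i x := fun i x =>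
    mul_le_mul_of_nonneg_right (hwε i x) (hw i x)
  have h₁' := h₁.mono hε hsq
  have h₂' := h₂.mono (w₂ := fun i x => ε i * w i x) hε fun i x => (one_mul _).le
  have h₃' := (h₃.mono hε fun i x => (sq (w i x)).trans_le (hsq i x)).neg
  refine ((h₁'.add h₂').add h₃').congr fun i x => ?_
  have hmem : ((ub i x, 0) : Eu n × Eu r) ∈ U := by
    simpa [toEquilibrium] using hball (hKe _ (hzK i x))
  have hq00 := (hq0 _ hmem).1
  have he := (hq0 _ hmem).2
  have hD := Dv_cstar_apply (A21 := A21) he (deriv (ub i) x)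
  rw [← hvb, Dv_apply] at hD
  simp only [toEquilibrium, toKinetic, ContinuousLinearMap.comp_apply,
    ContinuousLinearMap.coe_fst', ContinuousLinearMap.coe_snd', ContinuousLinearMap.inl_apply,
    ContinuousLinearMap.inr_apply, hq00, hD, sub_apply]
  abel

end System

/-- **First-order case of Corollary 3.2 of the paper.**  The Chapman–Enskog
approximate profile `(ū, c_*(ū)ū')` solves the traveling-wave equations up to
residuals of order `ε⁴` (fluid equation) and `ε³` (kinetic equation), with
exponential decay at rate `θε`. -/
theorem chapman_enskog_residual_bounds
    (n r : ℕ) (hn : 0 < n) (hr : 0 < r)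
    (𝒰 : Set (Eu n × Eu r)) (u₀ : Eu n) (h𝒰 : IsOpen 𝒰) (hu₀ : ((u₀, 0) : Eu n × Eu r) ∈ 𝒰)
    (f : Eu n × Eu r → Eu n) (q : Eu n × Eu r → Eu r)
    (A21 : Eu n × Eu r → (Eu n →L[ℝ] Eu r)) (A22 : Eu n × Eu r → (Eu r →L[ℝ] Eu r))
    (hf : ContDiffOn ℝ (⊤ : ℕ∞) f 𝒰) (hq : ContDiffOn ℝ (⊤ : ℕ∞) q 𝒰)
    (hA21 : ContDiffOn ℝ (⊤ : ℕ∞) A21 𝒰) (hA22 : ContDiffOn ℝ (⊤ : ℕ∞) A22 𝒰)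
    (hq0 : ∀ u : Eu n, ((u, 0) : Eu n × Eu r) ∈ 𝒰 →
      q (u, 0) = 0 ∧ ∃ e : Eu r ≃L[ℝ] Eu r, (e : Eu r →L[ℝ] Eu r) = Dv q u)
    (Kmax : ℕ) (θ C₀ ρ₀ : ℝ) (hθ : 0 < θ) (hC₀ : 0 < C₀) (hρ₀ : 0 < ρ₀)
    (hball : closedBall ((u₀, 0) : Eu n × Eu r) ρ₀ ⊆ 𝒰) :
    ∃ ε₀ C : ℝ, 0 < ε₀ ∧ 0 < C ∧
      ∀ (um up : Eu n) (ub : ℝ → Eu n) (ε : ℝ),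
        ‖um - u₀‖ ≤ ρ₀ / 2 → ‖up - u₀‖ ≤ ρ₀ / 2 →
        fstar f up = fstar f um →
        ε = ‖up - um‖ → 0 < ε → ε ≤ ε₀ →
        ContDiff ℝ (⊤ : ℕ∞) ub →
        (∀ x : ℝ, ‖ub x - u₀‖ ≤ ρ₀) →
        (∀ x : ℝ, bstar f q A21 (ub x) (deriv ub x) = fstar f (ub x) - fstar f um) →
        Tendsto ub atBot (nhds um) → Tendsto ub atTop (nhds up) →
        (∀ k ≤ Kmax + 2,
          (∀ x : ℝ, 0 ≤ x →
            ‖iteratedDeriv k (fun y => ub y - up) x‖ ≤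
              C₀ * ε ^ (k + 1) * Real.exp (-(θ * ε * |x|))) ∧
          (∀ x : ℝ, x ≤ 0 →
            ‖iteratedDeriv k (fun y => ub y - um) x‖ ≤
              C₀ * ε ^ (k + 1) * Real.exp (-(θ * ε * |x|)))) →
        ∀ (vb : ℝ → Eu r) (Ru : ℝ → Eu n) (Rv : ℝ → Eu r),
          (∀ x, vb x = cstar q A21 (ub x) (deriv ub x)) →
          (∀ x, Ru x = f (ub x, vb x) - fstar f um) →
          (∀ x, Rv x = A21 (ub x, vb x) (deriv ub x) + A22 (ub x, vb x) (deriv vb x)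
              - q (ub x, vb x)) →
          ∀ k ≤ Kmax, ∀ x : ℝ,
            ‖iteratedDeriv k Ru x‖ ≤ C * ε ^ (k + 4) * Real.exp (-(θ * ε * |x|)) ∧
            ‖iteratedDeriv k Rv x‖ ≤ C * ε ^ (k + 3) * Real.exp (-(θ * ε * |x|)) := by
  let ι := {p : ℝ × (ℝ → Eu n) // 0 < p.1 ∧ p.1 ≤ 1 ∧ ContDiff ℝ ∞ p.2 ∧
    (∀ x, ‖p.2 x - u₀‖ ≤ ρ₀) ∧ ∀ k ≤ Kmax + 1, ∀ x,
      ‖iteratedDeriv k (deriv p.2) x‖ ≤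
        C₀ * p.1 ^ k * (p.1 ^ 2 * Real.exp (-(θ * p.1 * |x|)))}
  let e : ι → ℝ := fun i => i.1.1
  let w : ι → ℝ → ℝ := fun i x => e i ^ 2 * Real.exp (-(θ * e i * |x|))
  let U : ι → ℝ → Eu n := fun i => i.1.2
  let V : ι → ℝ → Eu r := fun i x => cstar q A21 (U i x) (deriv (U i) x)
  have he : ∀ i, 0 ≤ e i := fun i => i.2.1.le
  have he1 : ∀ i, e i ≤ 1 := fun i => i.2.2.1
  have hw : ∀ i x, 0 ≤ w i x := fun i x => by positivity
  have hwsq : ∀ i x, w i x ≤ e i ^ 2 := fun i x => by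
    have := he i
    exact mul_le_of_le_one_right (by positivity)
      (Real.exp_le_one_iff.2 (neg_nonpos.2 (by positivity)))
  have hwe : ∀ i x, w i x ≤ e i := fun i x =>
    (hwsq i x).trans (pow_le_of_le_one (he i) (he1 i) two_ne_zero)
  have hdU : ScaledBound (Kmax + 1) e w (fun i => deriv (U i)) :=
    ⟨fun i => (contDiff_infty_iff_deriv.1 i.2.2.2.1).2, C₀, hC₀.le, fun i => i.2.2.2.2.2⟩
  have hU : ScaledBound (Kmax + 1) e (fun _ _ => 1) U :=
    (ScaledBound.of_deriv_of_mem_closedBall he (fun i => i.2.2.2.1) (fun i => i.2.2.2.2.1)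
      (hdU.mono he hwe)).of_le (Kmax + 1).le_succ
  have hsub : closedBall u₀ ρ₀ ⊆ {u | ((u, 0) : Eu n × Eu r) ∈ 𝒰} := fun u hu =>
    hball (by rw [← closedBall_prod_same]; exact ⟨hu, mem_closedBall_self hρ₀.le⟩)
  have hV : ScaledBound (Kmax + 1) e w V :=
    ((hU.comp (h𝒰.preimage (by fun_prop)) (isCompact_closedBall u₀ ρ₀) hsub
      (contDiffOn_cstar h𝒰 hq hA21 fun u hu => (hq0 u hu).2)
      (fun i x => mem_closedBall_iff_norm.2 (i.2.2.2.2.1 x)) he).clm_apply he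
      (fun _ _ => zero_le_one) hdU).mono he fun i x => (one_mul _).le
  obtain ⟨M, hM, hVM⟩ := hV.2
  let ε₀ := min 1 (ρ₀ / (M + 1))
  have hε₀ : 0 < ε₀ := by positivity
  let κ := {i : ι // e i ≤ ε₀}
  let φ : κ → ι := Subtype.val
  have hzK : ∀ (j : κ) x, (U (φ j) x, V (φ j) x) ∈ closedBall ((u₀, 0) : Eu n × Eu r) ρ₀ := by
    intro j x
    rw [← closedBall_prod_same]
    refine ⟨mem_closedBall_iff_norm.2 ((φ j).2.2.2.2.1 x), mem_closedBall_zero_iff.2 ?_⟩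
    have h := hVM (φ j) 0 (Nat.zero_le _) x
    simp only [iteratedDeriv_zero, pow_zero, mul_one] at h
    calc ‖V (φ j) x‖ ≤ M * w (φ j) x := h
      _ ≤ (M + 1) * (ρ₀ / (M + 1)) := by
        gcongr
        · linarith
        · exact (hwe _ x).trans (j.2.trans (min_le_right _ _))
      _ = ρ₀ := by field_simp
  have hz : ScaledBound Kmax (fun j => e (φ j)) (fun _ _ => 1)
      (fun j x => (U (φ j) x, V (φ j) x)) :=
    ((hU.prodMk (hV.mono he fun i x => (hwe i x).trans (he1 i))).reindex φ).of_le Kmax.le_succ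
  have hkin : ScaledBound Kmax (fun j => e (φ j)) (fun j => w (φ j))
      (fun j x => toKinetic (Eu n) (Eu r) (U (φ j) x, V (φ j) x)) :=
    ((hV.reindex φ).of_le Kmax.le_succ).const_clm (ContinuousLinearMap.inr ℝ (Eu n) (Eu r))
  obtain ⟨-, B₁, hB₁, hRu⟩ := ScaledBound.sub_sub_equilibrium h𝒰 (isCompact_closedBall _ _) hball
    (convex_closedBall _ _) (fun p hp => toEquilibrium_mem_closedBall hp) hzK (fun j => he (φ j))
    (fun j => hw (φ j)) hz hkin hf
  obtain ⟨-, B₂, hB₂, hRv⟩ := ScaledBound.kinetic_residual h𝒰 hball hq hA21 hA22 hq0 hzK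
    (fun j => he (φ j)) (fun j => hw (φ j)) (fun j => hwe (φ j)) hz
    ((hdU.reindex φ).of_le Kmax.le_succ) (hV.reindex φ) (fun _ _ => rfl)
  refine ⟨ε₀, B₁ + B₂ + 1, hε₀, by positivity, ?_⟩
  intro um up ub ε _ _ _ _ hε hεε₀ hub hubρ hode _ _ hdecay vb Ru Rv hvb hRu_eq hRv_eq k hk x
  have hderiv : ∀ k ≤ Kmax + 1, ∀ x, ‖iteratedDeriv k (deriv ub) x‖ ≤
      C₀ * ε ^ k * (ε ^ 2 * Real.exp (-(θ * ε * |x|))) := by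
    intro k hk x
    obtain ⟨hp, hm⟩ := hdecay (k + 1) (by lia)
    rw [show C₀ * ε ^ k * (ε ^ 2 * Real.exp (-(θ * ε * |x|))) =
      C₀ * ε ^ (k + 1 + 1) * Real.exp (-(θ * ε * |x|)) by ring]
    rcases le_total 0 x with hx | hx
    · simpa only [iteratedDeriv_succ', deriv_sub_const_fun] using hp x hx
    · simpa only [iteratedDeriv_succ', deriv_sub_const_fun] using hm x hx
  let j : κ := ⟨⟨(ε, ub), hε, hεε₀.trans (min_le_left _ _), hub, hubρ, hderiv⟩, hεε₀⟩
  obtain rfl : vb = V (φ j) := funext hvb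
  set E := Real.exp (-(θ * ε * |x|))
  have hE1 : E ≤ 1 := Real.exp_le_one_iff.2 (neg_nonpos.2 (by positivity))
  have hE0 : 0 < E := Real.exp_pos _
  constructor
  · have hfun : Ru = fun x => f (U (φ j) x, V (φ j) x)
        - f (toEquilibrium (Eu n) (Eu r) (U (φ j) x, V (φ j) x))
        - fderiv ℝ f (toEquilibrium (Eu n) (Eu r) (U (φ j) x, V (φ j) x))
          (toKinetic (Eu n) (Eu r) (U (φ j) x, V (φ j) x)) := by
      funext y
      have h := hode y
      simp only [bstar, neg_apply, ContinuousLinearMap.comp_apply, Dv_apply,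
        ← hvb] at h
      rw [hRu_eq]
      change f (ub y, V (φ j) y) - fstar f um = f (ub y, V (φ j) y) - fstar f (ub y)
        - fderiv ℝ f (ub y, 0) (0, V (φ j) y)
      rw [sub_eq_add_neg _ (fderiv ℝ f (ub y, 0) (0, V (φ j) y)), h]
      abel
    rw [hfun]
    calc _ ≤ B₁ * ε ^ k * (ε ^ 2 * E) ^ 2 := hRu j k hk x
      _ = B₁ * ε ^ (k + 4) * (E * E) := by ring
      _ ≤ (B₁ + B₂ + 1) * ε ^ (k + 4) * (E * 1) := by gcongr; linarith
      _ = _ := by rw [mul_one]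
  · rw [show Rv = _ from funext hRv_eq]
    calc _ ≤ B₂ * ε ^ k * (ε * (ε ^ 2 * E)) := hRv j k hk x
      _ = B₂ * ε ^ (k + 3) * E := by ring
      _ ≤ _ := by gcongr; linarith

end
end

section
/- Let n, r ≥ 1 be integers, N := n+r, and let c > 0, C₀ > 0 be given. Then there exist ε₀ > 0 and C > 0, depending only on n, r, c, C₀, such that the following holds for every ε ∈ (0, ε₀]. Let A, K, M : ℝ → (N×N real matrices) and Q22 : ℝ → (r×r real matrices) be C¹ functions satisfying, for all x ∈ ℝ: A(x) is symmetric, K(x) is skew-symmetric, the operator norms of A(x), K(x), Q22(x), M(x) are at most C₀; wᵀQ22(x)w ≤ −c|w|² for all w ∈ ℝʳ; Wᵀ(K(x)A(x) − Q(x))W ≥ c|W|² for all W ∈ ℝᴺ, where Q(x) := diag(0_{n×n}, Q22(x)); the operator norms of A'(x), Q22'(x), K'(x) are at most C₀ε²; and (∫_ℝ ‖M'(x)‖² dx)^{1/2} ≤ C₀ ε^{5/2}. Let f : ℝ → ℝⁿ be C² with f, f', f'' square integrable, g : ℝ → ℝʳ be C¹ with g, g' square integrable, and U = (u, v) : ℝ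 → ℝⁿ×ℝʳ be C¹ with U, U' square integrable, satisfying for all x: A(x)U'(x) − Q(x)U(x) + ε²M(x)U(x) = (f'(x), g(x)). Then ‖U'‖_{L²} + ‖v‖_{L²} ≤ C(‖f‖_{L²} + ‖f'‖_{L²} + ‖f''‖_{L²} + ‖g‖_{L²} + ‖g'‖_{L²} + ε‖u‖_{L²}). -/
open Matrix MeasureTheory Set

/-- Euclidean norm of a vector given as a function. -/
noncomputable def eNorm {ι : Type*} [Fintype ι] (x : ι → ℝ) : ℝ :=
  Real.sqrt (∑ i, x i ^ 2)

/-- `L²(ℝ)` norm of a vector-valued function (Euclidean norm on values). -/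
noncomputable def L2v {ι : Type*} [Fintype ι] (f : ℝ → ι → ℝ) : ℝ :=
  Real.sqrt (∫ x : ℝ, ∑ i, f x i ^ 2)

/-- Entrywise derivative of a matrix-valued function of a real variable. -/
noncomputable def derivM {ι κ : Type*} (M : ℝ → Matrix ι κ ℝ) (x : ℝ) : Matrix ι κ ℝ :=
  Matrix.of fun i j => deriv (fun t => M t i j) x

/-- Squared Euclidean norm of a vector given as a function. -/
def sqNorm {ι : Type*} [Fintype ι] (x : ι → ℝ) : ℝ := ∑ i, x i ^ 2

lemma HasDerivAt.mulVec {ι κ : Type*} [Fintype ι] {B : ℝ → Matrix κ ι ℝ} {z : ℝ → ι → ℝ} {z' : ι → ℝ} {x : ℝ}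
    (hB : ∀ i j, ContDiff ℝ 1 fun t => B t i j) (hz : HasDerivAt z z' x) :
    HasDerivAt (fun t => B t *ᵥ z t) (derivM B x *ᵥ z x + B x *ᵥ z') x := by
  rw [hasDerivAt_pi] at hz ⊢
  intro i
  have hBd : ∀ j, HasDerivAt (fun t => B t i j) (derivM B x i j) x := fun j =>
    ((hB i j).differentiable one_ne_zero x).hasDerivAt
  have := HasDerivAt.fun_sum (u := Finset.univ) fun j _ => (hBd j).mul (hz j)
  simpa [Matrix.mulVec, _root_.dotProduct, Finset.sum_add_distrib] using this

lemma HasDerivAt.sumElim {ι κ : Type*} {a : ℝ → ι → ℝ} {b : ℝ → κ → ℝ} {a' : ι → ℝ} {b' : κ → ℝ} {x : ℝ}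
    (ha : HasDerivAt a a' x) (hb : HasDerivAt b b' x) :
    HasDerivAt (fun t => Sum.elim (a t) (b t)) (Sum.elim a' b') x := by
  rw [hasDerivAt_pi] at ha hb ⊢
  rintro (i | i)
  · exact ha i
  · exact hb i

lemma Continuous.sumElim_pi {ι κ : Type*} {a : ℝ → ι → ℝ} {b : ℝ → κ → ℝ}
    (ha : Continuous a) (hb : Continuous b) :
    Continuous fun t => (Sum.elim (a t) (b t) : ι ⊕ κ → ℝ) := by
  rw [continuous_pi_iff] at ha hb ⊢
  rintro (i | i)
  · exact ha i
  · exact hb i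

lemma continuous_matrix_of_contDiff {ι κ : Type*} {B : ℝ → Matrix κ ι ℝ}
    (hB : ∀ i j, ContDiff ℝ 1 fun t => B t i j) : Continuous B :=
  continuous_matrix fun i j => (hB i j).continuous

lemma continuous_derivM {ι κ : Type*} {B : ℝ → Matrix κ ι ℝ}
    (hB : ∀ i j, ContDiff ℝ 1 fun t => B t i j) : Continuous (derivM B) :=
  continuous_matrix fun i j => (hB i j).continuous_deriv le_rfl

section Vectors

variable {ι κ : Type*} [Fintype ι] [Fintype κ]

lemma eNorm_nonneg (x : ι → ℝ) : 0 ≤ eNorm x := Real.sqrt_nonneg _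

lemma sqNorm_nonneg (x : ι → ℝ) : 0 ≤ sqNorm x :=
  Finset.sum_nonneg fun _ _ => sq_nonneg _

lemma eNorm_sq (x : ι → ℝ) : eNorm x ^ 2 = sqNorm x :=
  Real.sq_sqrt (sqNorm_nonneg x)

lemma sqNorm_elim (x : ι → ℝ) (y : κ → ℝ) :
    sqNorm (Sum.elim x y) = sqNorm x + sqNorm y := by
  simp [sqNorm, Fintype.sum_sum_type]

lemma sqNorm_zero : sqNorm (0 : ι → ℝ) = 0 := by simp [sqNorm]

lemma dotProduct_self_eq_sqNorm (x : ι → ℝ) : x ⬝ᵥ x = sqNorm x := by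
  simp [dotProduct, sqNorm, sq]

lemma abs_dotProduct_le (x y : ι → ℝ) : |x ⬝ᵥ y| ≤ eNorm x * eNorm y := by
  refine abs_le_of_sq_le_sq ?_ (mul_nonneg (eNorm_nonneg x) (eNorm_nonneg y))
  rw [mul_pow, eNorm_sq, eNorm_sq]
  exact Finset.sum_mul_sq_le_sq_mul_sq _ _ _

lemma abs_dotProduct_mulVec_le {B : Matrix ι κ ℝ} {L : ℝ}
    (hB : ∀ y, eNorm (B *ᵥ y) ≤ L * eNorm y) (x : ι → ℝ) (y : κ → ℝ) :
    |x ⬝ᵥ (B *ᵥ y)| ≤ L * (eNorm x * eNorm y) := by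
  calc _ ≤ eNorm x * eNorm (B *ᵥ y) := abs_dotProduct_le _ _
    _ ≤ eNorm x * (L * eNorm y) := mul_le_mul_of_nonneg_left (hB y) (eNorm_nonneg x)
    _ = _ := by ring

lemma dotProduct_mulVec_comm {B : Matrix ι ι ℝ} (hB : B.IsSymm) (x y : ι → ℝ) :
    x ⬝ᵥ (B *ᵥ y) = y ⬝ᵥ (B *ᵥ x) := by
  rw [dotProduct_mulVec, ← mulVec_transpose, hB.eq, dotProduct_comm]

lemma mul_le_weighted_sq {δ : ℝ} (hδ : 0 < δ) (a b : ℝ) :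
    a * b ≤ δ / 2 * a ^ 2 + b ^ 2 / (2 * δ) := by
  have h : δ / 2 * a ^ 2 + b ^ 2 / (2 * δ) - a * b = (δ * a - b) ^ 2 / (2 * δ) := by
    field_simp
    ring
  have : 0 ≤ (δ * a - b) ^ 2 / (2 * δ) := by positivity
  linarith

lemma HasDerivAt.dotProduct {a b : ℝ → ι → ℝ} {a' b' : ι → ℝ} {x : ℝ}
    (ha : HasDerivAt a a' x) (hb : HasDerivAt b b' x) :
    HasDerivAt (fun t => a t ⬝ᵥ b t) (a' ⬝ᵥ b x + a x ⬝ᵥ b') x := by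
  rw [hasDerivAt_pi] at ha hb
  have := HasDerivAt.fun_sum (u := Finset.univ) fun i _ => (ha i).mul (hb i)
  simpa [_root_.dotProduct, Finset.sum_add_distrib] using this

lemma HasDerivAt.continuousAt_mul_of_eq_zero {p q : ℝ → ℝ} {q' x : ℝ} (hp : ContinuousAt p x)
    (hq : HasDerivAt q q' x) (h0 : q x = 0) :
    HasDerivAt (fun t => p t * q t) (p x * q') x := by
  rw [hasDerivAt_iff_tendsto_slope] at hq ⊢
  refine ((hp.tendsto.mono_left nhdsWithin_le_nhds).mul hq).congr fun t => ?_
  simp only [slope_def_field, h0]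
  ring

/-- If `B` is symmetric and differentiable and `B W` is differentiable, the quadratic form
`W ⬝ᵥ B W` is differentiable even when `W` is merely continuous. -/
lemma hasDerivAt_quadratic {B : ℝ → Matrix ι ι ℝ} {W : ℝ → ι → ℝ} {Y' : ι → ℝ} {x : ℝ}
    (hB : ∀ i j, ContDiff ℝ 1 fun t => B t i j) (hsymm : ∀ t, (B t).IsSymm)
    (hW : Continuous W) (hY : HasDerivAt (fun t => B t *ᵥ W t) Y' x) :
    HasDerivAt (fun t => W t ⬝ᵥ (B t *ᵥ W t))
      (2 * (W x ⬝ᵥ Y') - W x ⬝ᵥ (derivM B x *ᵥ W x)) x := by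
  have hW' : ∀ i, ContinuousAt (fun t => W t i) x := fun i =>
    ((continuous_apply i).comp hW).continuousAt
  have hBd : ∀ i j, HasDerivAt (fun t => B t i j) (derivM B x i j) x := fun i j =>
    ((hB i j).differentiable one_ne_zero x).hasDerivAt
  have h1 := HasDerivAt.fun_sum (u := Finset.univ) fun i _ =>
    HasDerivAt.continuousAt_mul_of_eq_zero ((hW' i).add (continuousAt_const (y := W x i)))
      ((hasDerivAt_pi.1 hY i).sub_const ((B x *ᵥ W x) i)) (sub_self _)
  have h2 := HasDerivAt.fun_sum (u := Finset.univ) fun i _ =>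
    HasDerivAt.fun_sum (u := Finset.univ) fun j _ =>
      HasDerivAt.continuousAt_mul_of_eq_zero ((continuousAt_const (y := W x i)).mul (hW' j))
        ((hBd i j).sub_const (B x i j)) (sub_self _)
  have h3 := (h1.sub h2).add_const (W x ⬝ᵥ (B x *ᵥ W x))
  refine (h3.congr_deriv ?_).congr_of_eventuallyEq (Filter.Eventually.of_forall fun t => ?_)
  · simp only [_root_.dotProduct, Matrix.mulVec, Finset.mul_sum, Pi.add_apply, Pi.mul_apply]
    congr 1
    · exact Finset.sum_congr rfl fun i _ => by ring
    · exact Finset.sum_congr rfl fun i _ => Finset.sum_congr rfl fun j _ => by ring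
  · have e1 : ∑ i, (W t i + W x i) * ((B t *ᵥ W t) i - (B x *ᵥ W x) i)
        = (W t + W x) ⬝ᵥ (B t *ᵥ W t - B x *ᵥ W x) := rfl
    have e2 : ∑ i, ∑ j, W x i * W t j * (B t i j - B x i j)
        = W x ⬝ᵥ ((B t - B x) *ᵥ W t) := by
      simp only [_root_.dotProduct, Matrix.mulVec, Finset.mul_sum, Matrix.sub_apply]
      exact Finset.sum_congr rfl fun i _ => Finset.sum_congr rfl fun j _ => by ring
    have e3 := dotProduct_mulVec_comm (hsymm x) (W t) (W x)
    change _ = ∑ i, (W t i + W x i) * ((B t *ᵥ W t) i - (B x *ᵥ W x) i) -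
      ∑ i, ∑ j, W x i * W t j * (B t i j - B x i j) + _
    rw [e1, e2]
    simp only [add_dotProduct, dotProduct_sub, sub_mulVec]
    linarith

end Vectors

section Integrals

lemma Integrable.linearCombination₅ {f₁ f₂ f₃ f₄ f₅ : ℝ → ℝ} (h₁ : Integrable f₁)
    (h₂ : Integrable f₂) (h₃ : Integrable f₃) (h₄ : Integrable f₄) (h₅ : Integrable f₅)
    (a₁ a₂ a₃ a₄ a₅ : ℝ) :
    Integrable (fun x => a₁ * f₁ x + a₂ * f₂ x + a₃ * f₃ x + a₄ * f₄ x + a₅ * f₅ x) ∧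
      ∫ x, (a₁ * f₁ x + a₂ * f₂ x + a₃ * f₃ x + a₄ * f₄ x + a₅ * f₅ x) =
        a₁ * (∫ x, f₁ x) + a₂ * (∫ x, f₂ x) + a₃ * (∫ x, f₃ x) + a₄ * (∫ x, f₄ x)
          + a₅ * ∫ x, f₅ x := by
  have i₁ := h₁.const_mul a₁
  have i₂ := h₂.const_mul a₂
  have i₃ := h₃.const_mul a₃
  have i₄ := h₄.const_mul a₄
  have i₅ := h₅.const_mul a₅
  have j₂ : Integrable fun x => a₁ * f₁ x + a₂ * f₂ x := i₁.add i₂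
  have j₃ : Integrable fun x => a₁ * f₁ x + a₂ * f₂ x + a₃ * f₃ x := j₂.add i₃
  have j₄ : Integrable fun x => a₁ * f₁ x + a₂ * f₂ x + a₃ * f₃ x + a₄ * f₄ x := j₃.add i₄
  refine ⟨j₄.add i₅, ?_⟩
  rw [integral_add j₄ i₅, integral_add j₃ i₄, integral_add j₂ i₃, integral_add i₁ i₂]
  simp only [integral_const_mul]

/-- Integrated form of a dissipative energy balance `φ' = s + R`. -/
lemma integral_dissipation_le {φ s R a H H₁ : ℝ → ℝ} {c C : ℝ}
    (hφ : ∀ x, HasDerivAt φ (s x + R x) x) (hcont : Continuous fun x => s x + R x)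
    (ha : Integrable a) (hH : Integrable H) (hH₁ : Integrable H₁)
    (hsa : ∀ x, s x ≤ -c * a x) (hs : ∀ x, |s x| ≤ C * a x) (hR : ∀ x, |R x| ≤ H x)
    (hφH : ∀ x, |φ x| ≤ H₁ x) : c * ∫ x, a x ≤ ∫ x, H x := by
  have hφc : Continuous φ := continuous_iff_continuousAt.2 fun x => (hφ x).continuousAt
  have hφi : Integrable φ := hH₁.mono' hφc.aestronglyMeasurable (.of_forall hφH)
  have hφ'i : Integrable fun x => s x + R x :=
    ((ha.const_mul C).add hH).mono' hcont.aestronglyMeasurable (.of_forall fun x =>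
      (abs_add_le _ _).trans (add_le_add (hs x) (hR x)))
  have h0 := integral_eq_zero_of_hasDerivAt_of_integrable hφ hφ'i hφi
  rw [← integral_const_mul]
  have h1 : ∫ x, c * a x ≤ ∫ x, (H x - (s x + R x)) :=
    integral_mono (ha.const_mul c) (hH.sub hφ'i) fun x => by
      have := hsa x
      have := le_abs_self (R x)
      have := hR x
      simp only
      linarith
  rwa [integral_sub hH hφ'i, h0, sub_zero] at h1

/-- Agmon-type bound for `U` with `U` and `U'` square integrable. -/
lemma sqNorm_le_integral {ι : Type*} [Fintype ι] {U W : ℝ → ι → ℝ}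
    (hU : ∀ x, HasDerivAt U (W x) x) (hW : Continuous W)
    (hUi : Integrable fun x => sqNorm (U x)) (hWi : Integrable fun x => sqNorm (W x)) (x : ℝ) :
    sqNorm (U x) ≤ (∫ t, sqNorm (U t)) + ∫ t, sqNorm (W t) := by
  have hUc : Continuous U := continuous_iff_continuousAt.2 fun x => (hU x).continuousAt
  have hd : ∀ t, HasDerivAt (fun t => sqNorm (U t)) (2 * (U t ⬝ᵥ W t)) t := fun t => by
    have := (hU t).dotProduct (hU t)
    simp only [dotProduct_self_eq_sqNorm] at this
    refine this.congr_deriv ?_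
    rw [dotProduct_comm]
    ring
  have hle : ∀ t, |2 * (U t ⬝ᵥ W t)| ≤ sqNorm (U t) + sqNorm (W t) := fun t => by
    rw [abs_mul, abs_two]
    have := abs_dotProduct_le (U t) (W t)
    have := two_mul_le_add_sq (eNorm (U t)) (eNorm (W t))
    rw [eNorm_sq, eNorm_sq] at this
    linarith
  have hdc : Continuous fun t => 2 * (U t ⬝ᵥ W t) :=
    continuous_const.mul (hUc.dotProduct hW)
  have hdi : Integrable fun t => 2 * (U t ⬝ᵥ W t) :=
    (hUi.add hWi).mono' hdc.aestronglyMeasurable (.of_forall hle)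
  have hlim := tendsto_zero_of_hasDerivAt_of_integrableOn_Iic (a := x) (fun t _ => hd t)
    hdi.integrableOn hUi.integrableOn
  have heq := integral_Iic_of_hasDerivAt_of_tendsto' (a := x) (fun t _ => hd t)
    hdi.integrableOn hlim
  rw [sub_zero] at heq
  rw [← heq, ← integral_add hUi hWi]
  calc _ ≤ ∫ t in Iic x, (sqNorm (U t) + sqNorm (W t)) :=
        setIntegral_mono hdi.integrableOn (hUi.add hWi).integrableOn fun t =>
          (le_abs_self _).trans (hle t)
    _ ≤ _ := setIntegral_le_integral (hUi.add hWi) (.of_forall fun t =>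
        add_nonneg (sqNorm_nonneg _) (sqNorm_nonneg _))

end Integrals

set_option maxHeartbeats 1000000 in
/-- The integrated microscopic, Kawashima and differentiated estimates combine to a bound on
`W + V`, for small `e`. -/
lemma exists_const_of_energy_inequalities (c C₀ : ℝ) (hc : 0 < c) (hC₀ : 0 < C₀) :
    ∃ e₀ κ δ δ' : ℝ, 0 < e₀ ∧ 0 < κ ∧ 0 < δ ∧ 0 < δ' ∧
    ∀ e X V W P F₀ F₁ F₂ G₀ G₁ Z : ℝ, 0 ≤ e → e ≤ e₀ → 0 ≤ Z → 0 ≤ V → 0 ≤ W →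
      0 ≤ F₀ → 0 ≤ F₁ → 0 ≤ F₂ → 0 ≤ G₀ → 0 ≤ G₁ → X = Z + V →
      c * V ≤ c / 2 * V + 1 / (2 * c) * G₀ + 2 * C₀ * e * X + δ / 2 * W + 1 / (2 * δ) * F₀ →
      c * W ≤ c / 4 * W + 3 * C₀ ^ 2 / c * (C₀ ^ 2 * V + e * C₀ ^ 2 * X + (F₁ + G₀)) + C₀ * P →
      c * P ≤ e * (2 * C₀ * W + C₀ / 2 * V + 1 / 2 * W + C₀ ^ 2 / 2 * (X + W))
        + δ' / 2 * W + 1 / (2 * δ') * (F₂ + G₁) →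
      W + V ≤ κ * (F₀ + F₁ + F₂ + G₀ + G₁ + e * Z) := by
  obtain ⟨a, ha⟩ : ∃ a, a = 3 * C₀ ^ 4 / c := ⟨_, rfl⟩
  obtain ⟨δ', hδ'⟩ : ∃ d, d = c ^ 2 / (4 * C₀) := ⟨_, rfl⟩
  obtain ⟨β, hβ⟩ : ∃ b, b = 2 * (a + c) / c := ⟨_, rfl⟩
  obtain ⟨δ, hδ⟩ : ∃ d, d = c / (4 * β) := ⟨_, rfl⟩
  obtain ⟨γ, hγ⟩ : ∃ d, d = C₀ / c := ⟨_, rfl⟩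
  have ha0 : 0 < a := by rw [ha]; positivity
  have hδ'0 : 0 < δ' := by rw [hδ']; positivity
  have hβ0 : 0 < β := by rw [hβ]; positivity
  have hδ0 : 0 < δ := by rw [hδ]; positivity
  have hγ0 : 0 < γ := by rw [hγ]; positivity
  obtain ⟨q, hq⟩ : ∃ d, d = 3 * C₀ ^ 2 / c := ⟨_, rfl⟩
  have hq0 : 0 < q := by rw [hq]; positivity
  obtain ⟨k, hk⟩ : ∃ k, k = a + γ * (5 * C₀ / 2 + 1 / 2 + C₀ ^ 2 / 2) + 2 * C₀ * β := ⟨_, rfl⟩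
  have hk0 : 0 < k := by rw [hk]; positivity
  obtain ⟨K, hK⟩ : ∃ K, K = q + γ * (1 / (2 * δ')) + β * (1 / (2 * c)) + β * (1 / (2 * δ)) :=
    ⟨_, rfl⟩
  have hK0 : 0 < K := by rw [hK]; positivity
  refine ⟨c / (4 * k), 4 / c * (k + K), δ, δ', by positivity, by positivity, hδ0, hδ'0, ?_⟩
  intro e X V W P F₀ F₁ F₂ G₀ G₁ Z he hee hZ hV hW hF₀ hF₁ hF₂ hG₀ hG₁ hX h1 h2 h3
  have hek : e * k ≤ c / 4 := by
    calc e * k ≤ c / (4 * k) * k := by gcongr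
      _ = c / 4 := by field_simp
  have hX0 : 0 ≤ X := by linarith
  have h3' : C₀ * P ≤ γ * (e * (2 * C₀ * W + C₀ / 2 * V + 1 / 2 * W + C₀ ^ 2 / 2 * (X + W)))
      + c / 8 * W + γ * (1 / (2 * δ')) * (F₂ + G₁) := by
    have h := mul_le_mul_of_nonneg_left h3 hγ0.le
    have e1 : γ * (c * P) = C₀ * P := by rw [hγ]; field_simp
    have e2 : γ * (δ' / 2 * W) = c / 8 * W := by rw [hγ, hδ']; field_simp; ring
    rw [e1, mul_add, mul_add, e2, ← mul_assoc γ (1 / (2 * δ'))] at h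
    exact h
  have h1' : (a + c) * V ≤ β * (1 / (2 * c)) * G₀ + 2 * C₀ * β * (e * X) + c / 8 * W
      + β * (1 / (2 * δ)) * F₀ := by
    have h := mul_le_mul_of_nonneg_left
      (show c / 2 * V ≤ 1 / (2 * c) * G₀ + 2 * C₀ * e * X + δ / 2 * W + 1 / (2 * δ) * F₀
        by linarith) hβ0.le
    have e1 : β * (c / 2 * V) = (a + c) * V := by rw [hβ]; field_simp
    have e2 : β * (δ / 2 * W) = c / 8 * W := by rw [hδ]; field_simp; ring
    rw [e1] at h
    linarith
  have h2' : c * W ≤ c / 4 * W + a * V + a * (e * X) + q * (F₁ + G₀) + C₀ * P := by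
    have e1 : 3 * C₀ ^ 2 / c * (C₀ ^ 2 * V + e * C₀ ^ 2 * X + (F₁ + G₀))
        = a * V + a * (e * X) + q * (F₁ + G₀) := by
      rw [ha, hq]; field_simp
    linarith
  have hVX : V ≤ X := by linarith
  have h4 : γ * (e * (2 * C₀ * W + C₀ / 2 * V + 1 / 2 * W + C₀ ^ 2 / 2 * (X + W)))
      ≤ γ * (5 * C₀ / 2 + 1 / 2 + C₀ ^ 2 / 2) * (e * (X + W)) := by
    have : 2 * C₀ * W + C₀ / 2 * V + 1 / 2 * W + C₀ ^ 2 / 2 * (X + W)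
        ≤ (5 * C₀ / 2 + 1 / 2 + C₀ ^ 2 / 2) * (X + W) := by
      nlinarith [mul_nonneg hC₀.le hW, mul_nonneg hC₀.le hX0, mul_le_mul_of_nonneg_left hVX hC₀.le]
    calc _ ≤ γ * (e * ((5 * C₀ / 2 + 1 / 2 + C₀ ^ 2 / 2) * (X + W))) := by gcongr
      _ = _ := by ring
  have h5 : a * (e * X) + γ * (5 * C₀ / 2 + 1 / 2 + C₀ ^ 2 / 2) * (e * (X + W))
      + 2 * C₀ * β * (e * X) ≤ k * (e * (X + W)) := by
    have : 0 ≤ (a + 2 * C₀ * β) * (e * W) := by positivity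
    rw [hk]
    linarith
  have h6 : q * (F₁ + G₀) + γ * (1 / (2 * δ')) * (F₂ + G₁) + β * (1 / (2 * c)) * G₀
      + β * (1 / (2 * δ)) * F₀ ≤ K * (F₀ + F₁ + F₂ + G₀ + G₁) := by
    have t1 : 0 ≤ q * (F₀ + F₂ + G₁) := by positivity
    have t2 : 0 ≤ γ * (1 / (2 * δ')) * (F₀ + F₁ + G₀) := by positivity
    have t3 : 0 ≤ β * (1 / (2 * c)) * (F₀ + F₁ + F₂ + G₁) := by positivity
    have t4 : 0 ≤ β * (1 / (2 * δ)) * (F₁ + F₂ + G₀ + G₁) := by positivity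
    rw [hK]
    linarith
  have h7 : k * (e * (X + W)) ≤ k * (e * Z) + c / 4 * V + c / 4 * W := by
    have t := mul_le_mul_of_nonneg_right hek (add_nonneg hV hW)
    rw [hX]
    linarith
  have h8 : c / 4 * (W + V) ≤ k * (e * Z) + K * (F₀ + F₁ + F₂ + G₀ + G₁) := by
    have : 0 ≤ c * V := by positivity
    linarith
  have h9 : c / 4 * (W + V) ≤ (k + K) * (F₀ + F₁ + F₂ + G₀ + G₁ + e * Z) := by
    have t1 : 0 ≤ k * (F₀ + F₁ + F₂ + G₀ + G₁) := by positivity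
    have t2 : 0 ≤ K * (e * Z) := by positivity
    linarith
  have h10 : ∀ s t : ℝ, c / 4 * s ≤ t → s ≤ 4 / c * t := fun s t h => by
    rw [div_mul_eq_mul_div, le_div_iff₀ hc]
    linarith
  rw [mul_assoc]
  exact h10 _ _ h9

/-- Passing from squared norms to norms. -/
lemma sqrt_add_sqrt_le_of_add_le {κ W V F₀ F₁ F₂ G₀ G₁ Z ε : ℝ} (hκ : 0 < κ) (hε : 0 ≤ ε)
    (hW : 0 ≤ W) (hV : 0 ≤ V) (hF₀ : 0 ≤ F₀) (hF₁ : 0 ≤ F₁) (hF₂ : 0 ≤ F₂) (hG₀ : 0 ≤ G₀)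
    (hG₁ : 0 ≤ G₁) (hZ : 0 ≤ Z)
    (h : W + V ≤ κ * (F₀ + F₁ + F₂ + G₀ + G₁ + ε ^ 2 * Z)) :
    √W + √V ≤ √(2 * κ) * (√F₀ + √F₁ + √F₂ + √G₀ + √G₁ + ε * √Z) := by
  refine le_of_sq_le_sq ?_ (by positivity)
  rw [mul_pow, Real.sq_sqrt (by positivity)]
  have h1 : (√W + √V) ^ 2 ≤ 2 * (W + V) := by
    nlinarith [sq_nonneg (√W - √V), Real.sq_sqrt hW, Real.sq_sqrt hV]
  have key : ∀ a b : ℝ, 0 ≤ a → 0 ≤ b → a ^ 2 + b ^ 2 ≤ (a + b) ^ 2 := fun a b ha hb => by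
    nlinarith [mul_nonneg ha hb]
  have k1 := key √F₀ √F₁ (by positivity) (by positivity)
  have k2 := key (√F₀ + √F₁) √F₂ (by positivity) (by positivity)
  have k3 := key (√F₀ + √F₁ + √F₂) √G₀ (by positivity) (by positivity)
  have k4 := key (√F₀ + √F₁ + √F₂ + √G₀) √G₁ (by positivity) (by positivity)
  have k5 := key (√F₀ + √F₁ + √F₂ + √G₀ + √G₁) (ε * √Z) (by positivity) (by positivity)
  rw [mul_pow, Real.sq_sqrt hZ] at k5
  rw [Real.sq_sqrt hF₀, Real.sq_sqrt hF₁] at k1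
  rw [Real.sq_sqrt hF₂] at k2
  rw [Real.sq_sqrt hG₀] at k3
  rw [Real.sq_sqrt hG₁] at k4
  have h2 : F₀ + F₁ + F₂ + G₀ + G₁ + ε ^ 2 * Z
      ≤ (√F₀ + √F₁ + √F₂ + √G₀ + √G₁ + ε * √Z) ^ 2 := by linarith
  have h3 := mul_le_mul_of_nonneg_left h2 hκ.le
  linarith

section Energy

variable {ι κ : Type*} [Fintype ι] [Fintype κ] {c C₀ e δ : ℝ}
  {A K M : ℝ → Matrix (ι ⊕ κ) (ι ⊕ κ) ℝ} {Q : ℝ → Matrix κ κ ℝ}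
  {u u' f f' f'' : ℝ → ι → ℝ} {v v' g g' : ℝ → κ → ℝ}

lemma eNorm_le_eNorm_elim_left (x : ι → ℝ) (y : κ → ℝ) : eNorm x ≤ eNorm (Sum.elim x y) := by
  refine Real.sqrt_le_sqrt ?_
  change sqNorm x ≤ sqNorm (Sum.elim x y)
  rw [sqNorm_elim]
  linarith [sqNorm_nonneg y]

lemma eNorm_le_eNorm_elim_right (x : ι → ℝ) (y : κ → ℝ) : eNorm y ≤ eNorm (Sum.elim x y) := by
  refine Real.sqrt_le_sqrt ?_
  change sqNorm y ≤ sqNorm (Sum.elim x y)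
  rw [sqNorm_elim]
  linarith [sqNorm_nonneg x]

/-- Energy estimate for the microscopic component `v`. -/
lemma integral_microscopic_le (hC₀ : 0 < C₀) (hc : 0 < c) (he : 0 ≤ e) (hδ : 0 < δ)
    (hA : ∀ i j, ContDiff ℝ 1 fun x => A x i j) (hM : Continuous M) (hQ : Continuous Q)
    (hAs : ∀ x, (A x).IsSymm) (hAb : ∀ x y, eNorm (A x *ᵥ y) ≤ C₀ * eNorm y)
    (hA'b : ∀ x y, eNorm (derivM A x *ᵥ y) ≤ C₀ * e * eNorm y)
    (hMb : ∀ x y, eNorm (M x *ᵥ y) ≤ C₀ * eNorm y)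
    (hQb : ∀ x y, eNorm (Q x *ᵥ y) ≤ C₀ * eNorm y)
    (hQc : ∀ x w, w ⬝ᵥ (Q x *ᵥ w) ≤ -c * sqNorm w)
    (hu : ∀ x, HasDerivAt u (u' x) x) (hv : ∀ x, HasDerivAt v (v' x) x)
    (hf : ∀ x, HasDerivAt f (f' x) x) (hu'c : Continuous u') (hgc : Continuous g)
    (hUi : Integrable fun x => sqNorm (Sum.elim (u x) (v x)))
    (hWi : Integrable fun x => sqNorm (Sum.elim (u' x) (v' x)))
    (hvi : Integrable fun x => sqNorm (v x))
    (hfi : Integrable fun x => sqNorm (f x)) (hgi : Integrable fun x => sqNorm (g x))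
    (heq : ∀ x, A x *ᵥ Sum.elim (u' x) (v' x)
      = Sum.elim (f' x) (Q x *ᵥ v x + g x) - e • (M x *ᵥ Sum.elim (u x) (v x))) :
    c * ∫ x, sqNorm (v x) ≤ c / 2 * (∫ x, sqNorm (v x)) + 1 / (2 * c) * (∫ x, sqNorm (g x))
      + 2 * C₀ * e * (∫ x, sqNorm (Sum.elim (u x) (v x)))
      + δ / 2 * (∫ x, sqNorm (Sum.elim (u' x) (v' x)))
      + 1 / (2 * δ) * ∫ x, sqNorm (f x) := by
  have huc : Continuous u := continuous_iff_continuousAt.2 fun x => (hu x).continuousAt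
  have hvc : Continuous v := continuous_iff_continuousAt.2 fun x => (hv x).continuousAt
  have hfc : Continuous f := continuous_iff_continuousAt.2 fun x => (hf x).continuousAt
  have hUc := huc.sumElim_pi hvc
  have hU : ∀ x, HasDerivAt (fun t => Sum.elim (u t) (v t)) (Sum.elim (u' x) (v' x)) x :=
    fun x => (hu x).sumElim (hv x)
  obtain ⟨hHi, hHe⟩ := Integrable.linearCombination₅ hvi hgi hUi hWi hfi
    (c / 2) (1 / (2 * c)) (2 * C₀ * e) (δ / 2) (1 / (2 * δ))
  rw [← hHe]
  refine integral_dissipation_le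
    (φ := fun x => 1 / 2 * (Sum.elim (u x) (v x) ⬝ᵥ (A x *ᵥ Sum.elim (u x) (v x))) - u x ⬝ᵥ f x)
    (s := fun x => v x ⬝ᵥ (Q x *ᵥ v x))
    (R := fun x => v x ⬝ᵥ g x - e * (Sum.elim (u x) (v x) ⬝ᵥ (M x *ᵥ Sum.elim (u x) (v x)))
      + 1 / 2 * (Sum.elim (u x) (v x) ⬝ᵥ (derivM A x *ᵥ Sum.elim (u x) (v x))) - u' x ⬝ᵥ f x)
    (H₁ := fun x => C₀ * sqNorm (Sum.elim (u x) (v x)) + (sqNorm (Sum.elim (u x) (v x))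
      + sqNorm (f x)))
    (C := C₀) (fun x => ?_) ?_ hvi hHi
    ((hUi.const_mul C₀).add (hUi.add hfi)) (fun x => hQc x _) (fun x => ?_) (fun x => ?_)
    (fun x => ?_)
  · have h := (((hU x).dotProduct (HasDerivAt.mulVec hA (hU x))).const_mul (1 / 2)).sub
      ((hu x).dotProduct (hf x))
    refine h.congr_deriv ?_
    have e1 := dotProduct_mulVec_comm (hAs x) (Sum.elim (u' x) (v' x)) (Sum.elim (u x) (v x))
    have e2 := congrArg (fun z => Sum.elim (u x) (v x) ⬝ᵥ z) (heq x)
    simp only [dotProduct_sub, dotProduct_smul, smul_eq_mul, sumElim_dotProduct_sumElim,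
      dotProduct_add] at e2 e1 ⊢
    linarith
  · have := continuous_derivM hA
    exact (hvc.dotProduct (hQ.matrix_mulVec hvc)).add ((((hvc.dotProduct hgc).sub
      (continuous_const.mul (hUc.dotProduct (hM.matrix_mulVec hUc)))).add
      (continuous_const.mul (hUc.dotProduct (this.matrix_mulVec hUc)))).sub
      (hu'c.dotProduct hfc))
  · have := abs_dotProduct_mulVec_le (hQb x) (v x) (v x)
    rwa [← sq, eNorm_sq] at this
  · have b1 := (abs_dotProduct_le (v x) (g x)).trans (mul_le_weighted_sq hc _ _)
    have b2 := mul_le_mul_of_nonneg_left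
      (abs_dotProduct_mulVec_le (hMb x) (Sum.elim (u x) (v x)) (Sum.elim (u x) (v x))) he
    have b3 := abs_dotProduct_mulVec_le (hA'b x) (Sum.elim (u x) (v x)) (Sum.elim (u x) (v x))
    have b4 := ((abs_dotProduct_le (u' x) (f x)).trans (mul_le_mul_of_nonneg_right
      (eNorm_le_eNorm_elim_left (u' x) (v' x)) (eNorm_nonneg _))).trans
      (mul_le_weighted_sq hδ _ _)
    rw [← abs_of_nonneg he, ← abs_mul, abs_of_nonneg he] at b2
    rw [← sq, eNorm_sq] at b2 b3
    simp only [eNorm_sq] at b1 b4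
    have hX : 0 ≤ C₀ * e * sqNorm (Sum.elim (u x) (v x)) :=
      mul_nonneg (mul_nonneg hC₀.le he) (sqNorm_nonneg _)
    rw [div_eq_mul_one_div (sqNorm (g x)), mul_comm (sqNorm (g x))] at b1
    rw [div_eq_mul_one_div (sqNorm (f x)), mul_comm (sqNorm (f x))] at b4
    rw [abs_le] at b1 b2 b3 b4 ⊢
    constructor <;> linarith [b1.1, b1.2, b2.1, b2.2, b3.1, b3.2, b4.1, b4.2]
  · have b1 := abs_dotProduct_mulVec_le (hAb x) (Sum.elim (u x) (v x)) (Sum.elim (u x) (v x))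
    have b2 := (abs_dotProduct_le (u x) (f x)).trans (mul_le_mul_of_nonneg_right
      (eNorm_le_eNorm_elim_left (u x) (v x)) (eNorm_nonneg _))
    have b3 := two_mul_le_add_sq (eNorm (Sum.elim (u x) (v x))) (eNorm (f x))
    have p := mul_nonneg (eNorm_nonneg (Sum.elim (u x) (v x))) (eNorm_nonneg (f x))
    rw [← sq, eNorm_sq] at b1
    simp only [eNorm_sq] at b3
    rw [abs_le] at b1 b2 ⊢
    have := mul_nonneg hC₀.le (sqNorm_nonneg (Sum.elim (u x) (v x)))
    constructor <;> linarith [b1.1, b1.2, b2.1, b2.2]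

/-- Kawashima-type estimate of `U'` by `v`, `v'` and the forcing. -/
lemma integral_kawashima_le (hC₀ : 0 < C₀) (hc : 0 < c) (he : 0 ≤ e) (he1 : e ≤ 1)
    (hKb : ∀ x y, eNorm (K x *ᵥ y) ≤ C₀ * eNorm y)
    (hMb : ∀ x y, eNorm (M x *ᵥ y) ≤ C₀ * eNorm y)
    (hQb : ∀ x y, eNorm (Q x *ᵥ y) ≤ C₀ * eNorm y)
    (hKA : ∀ x W, c * sqNorm W ≤ W ⬝ᵥ ((K x * A x - Matrix.fromBlocks 0 0 0 (Q x)) *ᵥ W))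
    (hUi : Integrable fun x => sqNorm (Sum.elim (u x) (v x)))
    (hWi : Integrable fun x => sqNorm (Sum.elim (u' x) (v' x)))
    (hvi : Integrable fun x => sqNorm (v x)) (hv'i : Integrable fun x => sqNorm (v' x))
    (hf'i : Integrable fun x => sqNorm (f' x)) (hgi : Integrable fun x => sqNorm (g x))
    (heq : ∀ x, A x *ᵥ Sum.elim (u' x) (v' x)
      = Sum.elim (f' x) (Q x *ᵥ v x + g x) - e • (M x *ᵥ Sum.elim (u x) (v x))) :
    c * (∫ x, sqNorm (Sum.elim (u' x) (v' x)))
      ≤ c / 4 * (∫ x, sqNorm (Sum.elim (u' x) (v' x))) + 3 * C₀ ^ 2 / c *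
        (C₀ ^ 2 * (∫ x, sqNorm (v x)) + e * C₀ ^ 2 * (∫ x, sqNorm (Sum.elim (u x) (v x)))
          + ((∫ x, sqNorm (f' x)) + ∫ x, sqNorm (g x))) + C₀ * ∫ x, sqNorm (v' x) := by
  have hb : ∀ x, (c - c / 4) * sqNorm (Sum.elim (u' x) (v' x)) ≤
      3 * C₀ ^ 2 / c * C₀ ^ 2 * sqNorm (v x)
      + 3 * C₀ ^ 2 / c * (e * C₀ ^ 2) * sqNorm (Sum.elim (u x) (v x))
      + 3 * C₀ ^ 2 / c * sqNorm (f' x) + 3 * C₀ ^ 2 / c * sqNorm (g x) + C₀ * sqNorm (v' x) := by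
    intro x
    obtain ⟨W, hW⟩ : ∃ W, W = Sum.elim (u' x) (v' x) := ⟨_, rfl⟩
    obtain ⟨U, hU⟩ : ∃ U, U = Sum.elim (u x) (v x) := ⟨_, rfl⟩
    have h := hKA x W
    have hsplit : Sum.elim (f' x) (Q x *ᵥ v x + g x)
        = Sum.elim (f' x) (g x) + Sum.elim (0 : ι → ℝ) (Q x *ᵥ v x) := by
      ext (i | i) <;> simp [add_comm]
    have hexp : W ⬝ᵥ ((K x * A x - Matrix.fromBlocks 0 0 0 (Q x)) *ᵥ W)
        = W ⬝ᵥ (K x *ᵥ Sum.elim (f' x) (g x)) + W ⬝ᵥ (K x *ᵥ Sum.elim (0 : ι → ℝ) (Q x *ᵥ v x))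
          - e * (W ⬝ᵥ (K x *ᵥ (M x *ᵥ U))) - v' x ⬝ᵥ (Q x *ᵥ v' x) := by
      rw [sub_mulVec, ← mulVec_mulVec, hW, heq x, hsplit, ← hU, dotProduct_sub, mulVec_sub,
        mulVec_add, mulVec_smul, fromBlocks_mulVec]
      simp [dotProduct_sub, dotProduct_add, sumElim_dotProduct_sumElim]
    have hE0 : eNorm (Sum.elim (0 : ι → ℝ) (Q x *ᵥ v x)) ≤ C₀ * eNorm (v x) := by
      refine le_trans (le_of_eq ?_) (hQb x (v x))
      change √(sqNorm (Sum.elim (0 : ι → ℝ) (Q x *ᵥ v x))) = √(sqNorm (Q x *ᵥ v x))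
      rw [sqNorm_elim, sqNorm_zero, zero_add]
    have b1 := le_of_abs_le (abs_dotProduct_mulVec_le (hKb x) W (Sum.elim (f' x) (g x)))
    have b2 := (le_of_abs_le (abs_dotProduct_mulVec_le (hKb x) W
      (Sum.elim (0 : ι → ℝ) (Q x *ᵥ v x)))).trans (mul_le_mul_of_nonneg_left
      (mul_le_mul_of_nonneg_left hE0 (eNorm_nonneg W)) hC₀.le)
    have b3 := neg_le_of_abs_le (abs_dotProduct_mulVec_le (hKb x) W (M x *ᵥ U))
    have b3' := mul_le_mul_of_nonneg_left
      (mul_le_mul_of_nonneg_left (hMb x U) (eNorm_nonneg W)) hC₀.le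
    have b3'' : -(e * (W ⬝ᵥ (K x *ᵥ (M x *ᵥ U))))
        ≤ e * (C₀ * (eNorm W * (C₀ * eNorm U))) := by
      rw [← mul_neg]
      exact mul_le_mul_of_nonneg_left (by linarith) he
    have b4 := neg_le_of_abs_le (abs_dotProduct_mulVec_le (hQb x) (v' x) (v' x))
    rw [← sq, eNorm_sq] at b4
    have y := mul_le_weighted_sq (half_pos hc) (eNorm W)
      (C₀ * (eNorm (Sum.elim (f' x) (g x)) + C₀ * eNorm (v x) + e * C₀ * eNorm U))
    have hsq : ∀ p q r : ℝ, (p + q + r) ^ 2 ≤ 3 * (p ^ 2 + q ^ 2 + r ^ 2) := fun p q r => by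
      nlinarith [sq_nonneg (p - q), sq_nonneg (q - r), sq_nonneg (p - r)]
    have z := hsq (eNorm (Sum.elim (f' x) (g x))) (C₀ * eNorm (v x)) (e * C₀ * eNorm U)
    simp only [mul_pow, eNorm_sq, sqNorm_elim] at z y
    have he2 : e ^ 2 * C₀ ^ 2 * sqNorm U ≤ e * C₀ ^ 2 * sqNorm U := by
      have : e ^ 2 ≤ e := by nlinarith
      have := sqNorm_nonneg U
      gcongr
    have z' := mul_le_mul_of_nonneg_left (z.trans (mul_le_mul_of_nonneg_left
      (add_le_add_right he2 _) (by norm_num))) (show 0 ≤ C₀ ^ 2 / c by positivity)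
    rw [mul_div_cancel₀ c two_ne_zero, mul_div_right_comm] at y
    rw [← hW, ← hU]
    have e3 : 3 * C₀ ^ 2 / c = 3 * (C₀ ^ 2 / c) := by ring
    rw [e3]
    linarith
  obtain ⟨hHi, hHe⟩ := Integrable.linearCombination₅ hvi hUi hf'i hgi hv'i
    (3 * C₀ ^ 2 / c * C₀ ^ 2) (3 * C₀ ^ 2 / c * (e * C₀ ^ 2)) (3 * C₀ ^ 2 / c) (3 * C₀ ^ 2 / c) C₀
  have := integral_mono (hWi.const_mul (c - c / 4)) hHi hb
  rw [hHe, integral_const_mul] at this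
  linarith

/-- Energy estimate for `v'`, obtained from the differentiated equation without assuming that
`U'` is differentiable. -/
lemma integral_deriv_microscopic_le (hC₀ : 0 < C₀) (he : 0 ≤ e) (hδ : 0 < δ)
    {m : ℝ → ℝ} {S : ℝ} (hA : ∀ i j, ContDiff ℝ 1 fun x => A x i j)
    (hM : ∀ i j, ContDiff ℝ 1 fun x => M x i j) (hQ : ∀ i j, ContDiff ℝ 1 fun x => Q x i j)
    (hAs : ∀ x, (A x).IsSymm) (hAb : ∀ x y, eNorm (A x *ᵥ y) ≤ C₀ * eNorm y)
    (hA'b : ∀ x y, eNorm (derivM A x *ᵥ y) ≤ C₀ * e * eNorm y)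
    (hMb : ∀ x y, eNorm (M x *ᵥ y) ≤ C₀ * eNorm y)
    (hM'b : ∀ x y, eNorm (derivM M x *ᵥ y) ≤ m x * eNorm y)
    (hQb : ∀ x y, eNorm (Q x *ᵥ y) ≤ C₀ * eNorm y)
    (hQ'b : ∀ x y, eNorm (derivM Q x *ᵥ y) ≤ C₀ * e * eNorm y)
    (hQc : ∀ x w, w ⬝ᵥ (Q x *ᵥ w) ≤ -c * sqNorm w)
    (hu : ∀ x, HasDerivAt u (u' x) x) (hv : ∀ x, HasDerivAt v (v' x) x)
    (hf' : ∀ x, HasDerivAt f' (f'' x) x) (hg : ∀ x, HasDerivAt g (g' x) x)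
    (hu'c : Continuous u') (hv'c : Continuous v') (hf''c : Continuous f'') (hg'c : Continuous g')
    (hWi : Integrable fun x => sqNorm (Sum.elim (u' x) (v' x)))
    (hvi : Integrable fun x => sqNorm (v x)) (hv'i : Integrable fun x => sqNorm (v' x))
    (hf''i : Integrable fun x => sqNorm (f'' x)) (hg'i : Integrable fun x => sqNorm (g' x))
    (hmi : Integrable fun x => m x ^ 2) (hS : ∀ x, sqNorm (Sum.elim (u x) (v x)) ≤ S)
    (heq : ∀ x, A x *ᵥ Sum.elim (u' x) (v' x)
      = Sum.elim (f' x) (Q x *ᵥ v x + g x) - e • (M x *ᵥ Sum.elim (u x) (v x))) :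
    c * ∫ x, sqNorm (v' x) ≤
      (e * (2 * C₀ + 1 / 2) + δ / 2) * (∫ x, sqNorm (Sum.elim (u' x) (v' x)))
      + e * C₀ / 2 * (∫ x, sqNorm (v x)) + e * S / 2 * (∫ x, m x ^ 2)
      + 1 / (2 * δ) * (∫ x, sqNorm (f'' x)) + 1 / (2 * δ) * ∫ x, sqNorm (g' x) := by
  have huc : Continuous u := continuous_iff_continuousAt.2 fun x => (hu x).continuousAt
  have hvc : Continuous v := continuous_iff_continuousAt.2 fun x => (hv x).continuousAt
  have hUc := huc.sumElim_pi hvc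
  have hWc := hu'c.sumElim_pi hv'c
  have hFc := hf''c.sumElim_pi hg'c
  have hU : ∀ x, HasDerivAt (fun t => Sum.elim (u t) (v t)) (Sum.elim (u' x) (v' x)) x :=
    fun x => (hu x).sumElim (hv x)
  obtain ⟨hHi, hHe⟩ := Integrable.linearCombination₅ hWi hvi hmi hf''i hg'i
    (e * (2 * C₀ + 1 / 2) + δ / 2) (e * C₀ / 2) (e * S / 2) (1 / (2 * δ)) (1 / (2 * δ))
  rw [← hHe]
  refine integral_dissipation_le
    (φ := fun x => 1 / 2 * (Sum.elim (u' x) (v' x) ⬝ᵥ (A x *ᵥ Sum.elim (u' x) (v' x))))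
    (s := fun x => v' x ⬝ᵥ (Q x *ᵥ v' x))
    (R := fun x => Sum.elim (u' x) (v' x) ⬝ᵥ Sum.elim (f'' x) (g' x)
      + v' x ⬝ᵥ (derivM Q x *ᵥ v x)
      - e * (Sum.elim (u' x) (v' x) ⬝ᵥ (derivM M x *ᵥ Sum.elim (u x) (v x)))
      - e * (Sum.elim (u' x) (v' x) ⬝ᵥ (M x *ᵥ Sum.elim (u' x) (v' x)))
      - 1 / 2 * (Sum.elim (u' x) (v' x) ⬝ᵥ (derivM A x *ᵥ Sum.elim (u' x) (v' x))))
    (H₁ := fun x => C₀ * sqNorm (Sum.elim (u' x) (v' x)))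
    (C := C₀) (fun x => ?_) ?_ hv'i hHi (hWi.const_mul C₀)
    (fun x => hQc x _) (fun x => ?_) (fun x => ?_) (fun x => ?_)
  · have hY := ((hf' x).sumElim ((HasDerivAt.mulVec hQ (hv x)).add (hg x))).sub
      ((HasDerivAt.mulVec hM (hU x)).const_smul e)
    change HasDerivAt (fun t => Sum.elim (f' t) (Q t *ᵥ v t + g t)
      - e • (M t *ᵥ Sum.elim (u t) (v t))) _ x at hY
    rw [← funext heq] at hY
    refine ((hasDerivAt_quadratic hA hAs hWc hY).const_mul (1 / 2)).congr_deriv ?_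
    simp only [dotProduct_sub, dotProduct_smul, smul_eq_mul, sumElim_dotProduct_sumElim,
      dotProduct_add]
    ring
  · have hQ' := continuous_derivM hQ
    have hA' := continuous_derivM hA
    have hM' := continuous_derivM hM
    have hQ0 := continuous_matrix_of_contDiff hQ
    have hM0 := continuous_matrix_of_contDiff hM
    exact (hv'c.dotProduct (hQ0.matrix_mulVec hv'c)).add (((((hWc.dotProduct hFc).add
      (hv'c.dotProduct (hQ'.matrix_mulVec hvc))).sub
      (continuous_const.mul (hWc.dotProduct (hM'.matrix_mulVec hUc)))).sub
      (continuous_const.mul (hWc.dotProduct (hM0.matrix_mulVec hWc)))).sub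
      (continuous_const.mul (hWc.dotProduct (hA'.matrix_mulVec hWc))))
  · have := abs_dotProduct_mulVec_le (hQb x) (v' x) (v' x)
    rwa [← sq, eNorm_sq] at this
  · obtain ⟨W, hW⟩ : ∃ W, W = Sum.elim (u' x) (v' x) := ⟨_, rfl⟩
    obtain ⟨U, hU⟩ : ∃ U, U = Sum.elim (u x) (v x) := ⟨_, rfl⟩
    have hSU : sqNorm U ≤ S := hU ▸ hS x
    have hv'W : eNorm (v' x) ≤ eNorm W := hW ▸ eNorm_le_eNorm_elim_right (u' x) (v' x)
    rw [← hW, ← hU]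
    have b1 := (abs_dotProduct_le W (Sum.elim (f'' x) (g' x))).trans (mul_le_weighted_sq hδ _ _)
    have b2 : |v' x ⬝ᵥ (derivM Q x *ᵥ v x)| ≤ C₀ * e * ((sqNorm W + sqNorm (v x)) / 2) := by
      refine (abs_dotProduct_mulVec_le (hQ'b x) _ _).trans
        (mul_le_mul_of_nonneg_left ?_ (mul_nonneg hC₀.le he))
      have t1 := mul_le_mul_of_nonneg_right hv'W (eNorm_nonneg (v x))
      have t2 := two_mul_le_add_sq (eNorm W) (eNorm (v x))
      rw [eNorm_sq, eNorm_sq] at t2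
      linarith
    have b3 : |e * (W ⬝ᵥ (derivM M x *ᵥ U))| ≤ e * ((sqNorm W + m x ^ 2 * S) / 2) := by
      rw [abs_mul, abs_of_nonneg he]
      refine mul_le_mul_of_nonneg_left ((abs_dotProduct_mulVec_le (hM'b x) _ _).trans ?_) he
      have t1 := two_mul_le_add_sq (eNorm W) (m x * eNorm U)
      rw [mul_pow, eNorm_sq, eNorm_sq] at t1
      have t2 := mul_le_mul_of_nonneg_left hSU (sq_nonneg (m x))
      linarith
    have b4 : |e * (W ⬝ᵥ (M x *ᵥ W))| ≤ e * (C₀ * sqNorm W) := by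
      rw [abs_mul, abs_of_nonneg he, ← eNorm_sq W, sq]
      exact mul_le_mul_of_nonneg_left (abs_dotProduct_mulVec_le (hMb x) _ _) he
    have b5 := abs_dotProduct_mulVec_le (hA'b x) W W
    rw [← sq, eNorm_sq] at b5
    simp only [eNorm_sq, sqNorm_elim] at b1
    rw [div_eq_mul_one_div (sqNorm (f'' x) + sqNorm (g' x)), mul_comm (sqNorm (f'' x) + _)] at b1
    rw [abs_le] at b1 b2 b3 b4 b5 ⊢
    constructor <;>
      linarith [b1.1, b1.2, b2.1, b2.2, b3.1, b3.2, b4.1, b4.2, b5.1, b5.2]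
  · have b := abs_dotProduct_mulVec_le (hAb x) (Sum.elim (u' x) (v' x)) (Sum.elim (u' x) (v' x))
    rw [← sq, eNorm_sq] at b
    have := mul_nonneg hC₀.le (sqNorm_nonneg (Sum.elim (u' x) (v' x)))
    rw [abs_mul, abs_of_pos one_half_pos]
    linarith

end Energy

/-- **Lemma 6.2 of the paper: the basic H¹ Kawashima-type energy estimate.**
For the symmetrized linearized traveling-wave ODE
`A U' − Q U + ε² M U = (f', g)` with `Q = diag(0, Q22)`, under symmetry,
skew-symmetry, boundedness, dissipativity, the Kawashima condition and the
`O(ε²)` bounds on derivatives of coefficients, one has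
`‖U'‖_{L²} + ‖v‖_{L²} ≤ C(‖f‖ + ‖f'‖ + ‖f''‖ + ‖g‖ + ‖g'‖ + ε‖u‖)_{L²}`. -/
theorem basic_H1_energy_estimate (n r : ℕ) (hn : 1 ≤ n) (hr : 1 ≤ r)
    (c C₀ : ℝ) (hc : 0 < c) (hC₀ : 0 < C₀) :
    ∃ ε₀ C : ℝ, 0 < ε₀ ∧ 0 < C ∧
    ∀ ε : ℝ, ε ∈ Ioc (0 : ℝ) ε₀ →
    ∀ A K M : ℝ → Matrix (Fin n ⊕ Fin r) (Fin n ⊕ Fin r) ℝ,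
    ∀ Q22 : ℝ → Matrix (Fin r) (Fin r) ℝ,
    (∀ i j, ContDiff ℝ 1 fun x => A x i j) →
    (∀ i j, ContDiff ℝ 1 fun x => K x i j) →
    (∀ i j, ContDiff ℝ 1 fun x => M x i j) →
    (∀ i j, ContDiff ℝ 1 fun x => Q22 x i j) →
    (∀ x, (A x).IsSymm) →
    (∀ x, (K x)ᵀ = -(K x)) →
    (∀ x y, eNorm (A x *ᵥ y) ≤ C₀ * eNorm y) →
    (∀ x y, eNorm (K x *ᵥ y) ≤ C₀ * eNorm y) →
    (∀ x y, eNorm (M x *ᵥ y) ≤ C₀ * eNorm y) →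
    (∀ x (w : Fin r → ℝ), eNorm (Q22 x *ᵥ w) ≤ C₀ * eNorm w) →
    (∀ x (w : Fin r → ℝ), w ⬝ᵥ (Q22 x *ᵥ w) ≤ -c * ∑ i, w i ^ 2) →
    (∀ x (W : Fin n ⊕ Fin r → ℝ),
      c * ∑ j, W j ^ 2 ≤
        W ⬝ᵥ ((K x * A x - Matrix.fromBlocks 0 0 0 (Q22 x)) *ᵥ W)) →
    (∀ x y, eNorm (derivM A x *ᵥ y) ≤ C₀ * ε ^ 2 * eNorm y) →
    (∀ x (w : Fin r → ℝ), eNorm (derivM Q22 x *ᵥ w) ≤ C₀ * ε ^ 2 * eNorm w) →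
    (∀ x y, eNorm (derivM K x *ᵥ y) ≤ C₀ * ε ^ 2 * eNorm y) →
    (∃ mbd : ℝ → ℝ, (∀ x y, eNorm (derivM M x *ᵥ y) ≤ mbd x * eNorm y) ∧
      Integrable (fun x => mbd x ^ 2) ∧
      Real.sqrt (∫ x : ℝ, mbd x ^ 2) ≤ C₀ * ε ^ ((5 : ℝ) / 2)) →
    ∀ (f : ℝ → Fin n → ℝ) (g : ℝ → Fin r → ℝ)
      (u : ℝ → Fin n → ℝ) (v : ℝ → Fin r → ℝ),
    ContDiff ℝ 2 f → ContDiff ℝ 1 g → ContDiff ℝ 1 u → ContDiff ℝ 1 v →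
    Integrable (fun x => ∑ i, f x i ^ 2) →
    Integrable (fun x => ∑ i, deriv f x i ^ 2) →
    Integrable (fun x => ∑ i, iteratedDeriv 2 f x i ^ 2) →
    Integrable (fun x => ∑ i, g x i ^ 2) →
    Integrable (fun x => ∑ i, deriv g x i ^ 2) →
    Integrable (fun x => ∑ i, Sum.elim (u x) (v x) i ^ 2) →
    Integrable (fun x => ∑ i, Sum.elim (deriv u x) (deriv v x) i ^ 2) →
    (∀ x, A x *ᵥ Sum.elim (deriv u x) (deriv v x)
        - Matrix.fromBlocks 0 0 0 (Q22 x) *ᵥ Sum.elim (u x) (v x)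
        + ε ^ 2 • (M x *ᵥ Sum.elim (u x) (v x))
        = Sum.elim (deriv f x) (g x)) →
    L2v (fun x => Sum.elim (deriv u x) (deriv v x)) + L2v v ≤
      C * (L2v f + L2v (deriv f) + L2v (iteratedDeriv 2 f)
        + L2v g + L2v (deriv g) + ε * L2v u) := by
  obtain ⟨e₀, κ, δ, δ', he₀, hκ, hδ, hδ', hcomb⟩ :=
    exists_const_of_energy_inequalities c C₀ hc hC₀
  refine ⟨min 1 e₀, √(2 * κ), lt_min one_pos he₀, by positivity, ?_⟩
  intro ε hε A K M Q hA hK hM hQ hAs hKs hAb hKb hMb hQb hQc hKA hA'b hQ'b hK'b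
    ⟨m, hM'b, hmi, hm⟩ f g u v hf hg hu hv hfi hf'i hf''i hgi hg'i hUi hWi heq
  have hε0 : 0 ≤ ε := hε.1.le
  have hε1 : ε ≤ 1 := hε.2.trans (min_le_left _ _)
  have he : 0 ≤ ε ^ 2 := sq_nonneg ε
  have he1 : ε ^ 2 ≤ 1 := pow_le_one₀ hε0 hε1
  have hee₀ : ε ^ 2 ≤ e₀ := by
    have := hε.2.trans (min_le_right _ _)
    nlinarith
  change Integrable fun x => sqNorm (f x) at hfi
  change Integrable fun x => sqNorm (deriv f x) at hf'i
  change Integrable fun x => sqNorm (iteratedDeriv 2 f x) at hf''i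
  change Integrable fun x => sqNorm (g x) at hgi
  change Integrable fun x => sqNorm (deriv g x) at hg'i
  change Integrable fun x => sqNorm (Sum.elim (u x) (v x)) at hUi
  change Integrable fun x => sqNorm (Sum.elim (deriv u x) (deriv v x)) at hWi
  have hud : ∀ x, HasDerivAt u (deriv u x) x := fun x =>
    (hu.differentiable one_ne_zero x).hasDerivAt
  have hvd : ∀ x, HasDerivAt v (deriv v x) x := fun x =>
    (hv.differentiable one_ne_zero x).hasDerivAt
  have hgd : ∀ x, HasDerivAt g (deriv g x) x := fun x =>
    (hg.differentiable one_ne_zero x).hasDerivAt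
  have hfd : ∀ x, HasDerivAt f (deriv f x) x := fun x =>
    (hf.differentiable two_ne_zero x).hasDerivAt
  have hf'd : ∀ x, HasDerivAt (deriv f) (iteratedDeriv 2 f x) x := fun x => by
    rw [iteratedDeriv_succ, iteratedDeriv_one]
    have h1 : ContDiff ℝ 1 (deriv f) := (contDiff_succ_iff_deriv (n := 1)).1 hf |>.2.2
    exact (h1.differentiable one_ne_zero x).hasDerivAt
  have hu'c : Continuous (deriv u) := hu.continuous_deriv le_rfl
  have hv'c : Continuous (deriv v) := hv.continuous_deriv le_rfl
  have hg'c : Continuous (deriv g) := hg.continuous_deriv le_rfl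
  have hf''c : Continuous (iteratedDeriv 2 f) := hf.continuous_iteratedDeriv 2 le_rfl
  have hsc : ∀ {ι : Type} [Fintype ι] {w : ℝ → ι → ℝ}, Continuous w →
      Continuous fun x => sqNorm (w x) := fun hw =>
    continuous_finsetSum _ fun i _ => ((continuous_apply i).comp hw).pow 2
  have hui : Integrable fun x => sqNorm (u x) :=
    hUi.mono' (hsc hu.continuous).aestronglyMeasurable (.of_forall fun x => by
      rw [Real.norm_of_nonneg (sqNorm_nonneg _), sqNorm_elim]
      linarith [sqNorm_nonneg (v x)])
  have hvi : Integrable fun x => sqNorm (v x) :=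
    hUi.mono' (hsc hv.continuous).aestronglyMeasurable (.of_forall fun x => by
      rw [Real.norm_of_nonneg (sqNorm_nonneg _), sqNorm_elim]
      linarith [sqNorm_nonneg (u x)])
  have hv'i : Integrable fun x => sqNorm (deriv v x) :=
    hWi.mono' (hsc hv'c).aestronglyMeasurable (.of_forall fun x => by
      rw [Real.norm_of_nonneg (sqNorm_nonneg _), sqNorm_elim]
      linarith [sqNorm_nonneg (deriv u x)])
  have heq' : ∀ x, A x *ᵥ Sum.elim (deriv u x) (deriv v x)
      = Sum.elim (deriv f x) (Q x *ᵥ v x + g x) - ε ^ 2 • (M x *ᵥ Sum.elim (u x) (v x)) := by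
    intro x
    have hsum : Sum.elim (deriv f x) (Q x *ᵥ v x + g x)
        = Sum.elim (deriv f x) (g x)
          + Matrix.fromBlocks 0 0 0 (Q x) *ᵥ Sum.elim (u x) (v x) := by
      rw [fromBlocks_mulVec]
      ext (i | i) <;> simp [add_comm]
    rw [hsum, ← heq x]
    abel
  have hmL : ∫ x, m x ^ 2 ≤ C₀ ^ 2 := by
    have hpow : ε ^ ((5 : ℝ) / 2) ≤ 1 := Real.rpow_le_one hε0 hε1 (by norm_num)
    have h1 : √(∫ x, m x ^ 2) ≤ C₀ := hm.trans (mul_le_of_le_one_right hC₀.le hpow)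
    exact (Real.sqrt_le_left hC₀.le).1 h1
  have hint : ∀ {ι : Type} [Fintype ι] (w : ℝ → ι → ℝ), 0 ≤ ∫ x, sqNorm (w x) := fun w =>
    integral_nonneg fun x => sqNorm_nonneg (w x)
  have hXeq : ∫ x, sqNorm (Sum.elim (u x) (v x))
      = (∫ x, sqNorm (u x)) + ∫ x, sqNorm (v x) := by
    rw [← integral_add hui hvi]
    simp only [sqNorm_elim]
  have hX0 := hint fun x => Sum.elim (u x) (v x)
  have hW0 := hint fun x => Sum.elim (deriv u x) (deriv v x)
  have h1 := integral_microscopic_le hC₀ hc he hδ hA (continuous_matrix_of_contDiff hM)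
    (continuous_matrix_of_contDiff hQ) hAs hAb hA'b hMb hQb hQc hud hvd hfd hu'c hg.continuous
    hUi hWi hvi hfi hgi heq'
  have h2 := integral_kawashima_le hC₀ hc he he1 hKb hMb hQb hKA hUi hWi hvi hv'i hf'i hgi heq'
  have h3 := integral_deriv_microscopic_le hC₀ he hδ' hA hM hQ hAs hAb hA'b hMb hM'b hQb hQ'b hQc
    hud hvd hf'd hgd hu'c hv'c hf''c hg'c hWi hvi hv'i hf''i hg'i hmi
    (sqNorm_le_integral (fun x => (hud x).sumElim (hvd x)) (hu'c.sumElim_pi hv'c) hUi hWi) heq'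
  have h3' := mul_le_mul_of_nonneg_left hmL (mul_nonneg he (add_nonneg hX0 hW0))
  have hfin := hcomb (ε ^ 2) _ _ _ _ _ _ _ _ _ _ he hee₀ (hint u) (hint v) hW0 (hint f)
    (hint (deriv f)) (hint (iteratedDeriv 2 f)) (hint g) (hint (deriv g)) hXeq h1 h2
    (by linarith)
  exact sqrt_add_sqrt_le_of_add_le hκ hε0 hW0 (hint v) (hint f) (hint (deriv f))
    (hint (iteratedDeriv 2 f)) (hint g) (hint (deriv g)) (hint u) hfin
end
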